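/- Let μ be a locally finite signed Borel measure on [0,∞) whose Laplace–Stieltjes transform 𝓛{dS;s} = ∫_{[0,∞)} e^{−sx} dμ(x) converges absolutely for every complex s with Re s > 1, and let S(x) = μ([0,x]) be log-linearly slowly decreasing. Set U(s) = Re 𝓛{dS;s}. Assume U has L¹_loc-boundary behavior on 1 + i(ℝ∖{0}), and assume there exist λ > 0 and c ≥ 0 such that U(σ+it) ≥ −c for all t ∈ (−λ,λ) and all σ ∈ (1,2]. Then the limit a = lim_{σ→1⁺} (σ−1) U(σ) exists and S(x) ∼ a e^x as x → ∞, i.e. lim_{x→∞} e^{−x} S(x) = a. -/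

import Mathlib

open MeasureTheory Filter Set

/-- `S` is log-linearly slowly decreasing. -/
def LogLinSlowlyDecreasing (S : ℝ → ℝ) : Prop :=
  ∀ ε : ℝ, 0 < ε → ∃ h : ℝ, 0 < h ∧ ∃ x₀ : ℝ, 0 < x₀ ∧ ∀ x y : ℝ,
    x₀ ≤ x → x ≤ y → y ≤ x + h → (S y - S x) / Real.exp x ≥ -ε

/-- `U` (defined on `Re s > 1`) has `L¹_loc`-boundary behavior on `1 + i(ℝ∖{0})`. -/
def L1locBoundaryBehavior (U : ℂ → ℝ) : Prop :=
  ∃ f : ℝ → ℝ, ∀ a b : ℝ, a ≤ b → (0 : ℝ) ∉ Icc a b →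
    IntegrableOn f (Icc a b) ∧
    Tendsto (fun σ : ℝ => ∫ t in a..b, |U (σ + t * Complex.I) - f t|)
      (nhdsWithin 1 (Ioi 1)) (nhds 0)

/-- The Laplace–Stieltjes transform `∫_{[0,∞)} e^{-sx} dμ(x)` of the locally finite
signed measure `μ = μp - μm` on `[0,∞)`. -/
noncomputable def laplaceStieltjes (μp μm : Measure ℝ) (s : ℂ) : ℂ :=
  (∫ x : ℝ, Complex.exp (-s * x) ∂μp) - ∫ x : ℝ, Complex.exp (-s * x) ∂μm


/-! ### Fejér kernel -/

/-- Fejér kernel (as a cosine transform of the triangle function). -/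
noncomputable def fej (N z : ℝ) : ℝ := ∫ t in (0:ℝ)..N, (1 - t / N) * Real.cos (t * z)

/-- auxiliary symbol -/
noncomputable def symP (σ t z : ℝ) : ℝ :=
  (σ * Real.cos (t * z) + t * Real.sin (t * z)) / (σ ^ 2 + t ^ 2)

/-- auxiliary kernel -/
noncomputable def kerK (σ N z : ℝ) : ℝ := ∫ t in (0:ℝ)..N, (1 - t / N) * symP σ t z

lemma fej_formula {N z : ℝ} (hN : 0 < N) (hz : z ≠ 0) :
    fej N z = (1 - Real.cos (N * z)) / (N * z ^ 2) := by
  unfold fej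
  have h : ∀ t ∈ uIcc (0:ℝ) N, HasDerivAt
      (fun t => (1 - t / N) * (Real.sin (t * z) / z) - Real.cos (t * z) / (N * z ^ 2))
      ((1 - t / N) * Real.cos (t * z)) t := by
    intro t _
    have h1 : HasDerivAt (fun t : ℝ => t * z) z t := by
      simpa using (hasDerivAt_id t).mul_const z
    have h2 : HasDerivAt (fun t : ℝ => 1 - t / N) (-(1 / N)) t := by
      simpa using ((hasDerivAt_id t).div_const N).const_sub 1
    have h3 := (h2.mul (h1.sin.div_const z)).sub (h1.cos.div_const (N * z ^ 2))
    refine h3.congr_deriv ?_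
    field_simp
    ring
  rw [intervalIntegral.integral_eq_sub_of_hasDerivAt h
    (Continuous.intervalIntegrable (by fun_prop) _ _)]
  simp
  field_simp
  ring

lemma fej_zero {N : ℝ} (hN : 0 < N) : fej N 0 = N / 2 := by
  unfold fej
  simp only [mul_zero, Real.cos_zero, mul_one]
  rw [intervalIntegral.integral_sub (by simp) (Continuous.intervalIntegrable (by fun_prop) _ _)]
  simp [intervalIntegral.integral_div]
  field_simp
  ring

lemma fej_nonneg {N : ℝ} (hN : 0 < N) (z : ℝ) : 0 ≤ fej N z := by
  by_cases hz : z = 0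
  · rw [hz, fej_zero hN]; positivity
  · rw [fej_formula hN hz]
    have := Real.cos_le_one (N * z)
    apply div_nonneg (by linarith) (by positivity)

lemma fej_le {N : ℝ} (hN : 0 < N) (z : ℝ) : fej N z ≤ N / 2 := by
  rw [← fej_zero hN]
  unfold fej
  apply intervalIntegral.integral_mono_on hN.le
    (Continuous.intervalIntegrable (by fun_prop) _ _)
    (Continuous.intervalIntegrable (by fun_prop) _ _)
  intro t ht
  have : 0 ≤ 1 - t / N := by
    rw [sub_nonneg, div_le_one hN]; exact ht.2
  simp only [mul_zero, Real.cos_zero]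
  exact mul_le_mul_of_nonneg_left (Real.cos_le_one _) this

lemma fej_sq_mul {N : ℝ} (hN : 0 < N) (z : ℝ) : z ^ 2 * fej N z = (1 - Real.cos (N * z)) / N := by
  by_cases hz : z = 0
  · simp [hz]
  · rw [fej_formula hN hz]; field_simp

lemma fej_sq_le {N : ℝ} (hN : 0 < N) (z : ℝ) : z ^ 2 * fej N z ≤ 2 / N := by
  rw [fej_sq_mul hN]
  have := Real.neg_one_le_cos (N * z)
  gcongr; linarith

lemma fej_bound {N : ℝ} (hN : 0 < N) (z : ℝ) : fej N z ≤ (N / 2 + 2 / N) / (1 + z ^ 2) := by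
  rw [le_div_iff₀ (by positivity)]
  have := fej_le hN z
  have := fej_sq_le hN z
  linarith

lemma fej_cont (N : ℝ) : Continuous (fej N) := by
  unfold fej
  apply intervalIntegral.continuous_parametric_intervalIntegral_of_continuous' (f := fun z t => (1 - t / N) * Real.cos (t * z))
  fun_prop

lemma fej_neg (N z : ℝ) : fej N (-z) = fej N z := by
  unfold fej; simp

lemma fej_scale {N : ℝ} (hN : 0 < N) (z : ℝ) : fej N z = N * fej 1 (N * z) := by
  by_cases hz : z = 0
  · rw [hz, mul_zero, fej_zero hN, fej_zero one_pos]; ring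
  · rw [fej_formula hN hz, fej_formula one_pos (by positivity)]; field_simp

lemma fej_integrable {N : ℝ} (hN : 0 < N) : Integrable (fej N) := by
  refine Integrable.mono' (integrable_inv_one_add_sq.const_mul (N / 2 + 2 / N))
    (fej_cont N).aestronglyMeasurable (Eventually.of_forall fun z => ?_)
  rw [Real.norm_of_nonneg (fej_nonneg hN z)]
  simpa [div_eq_mul_inv] using fej_bound hN z

lemma fej_integral {N : ℝ} (hN : 0 < N) : ∫ z, fej N z = ∫ z, fej 1 z := by
  simp_rw [fej_scale hN]
  rw [integral_const_mul, Measure.integral_comp_mul_left (fej 1) N]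
  rw [abs_of_pos (by positivity), smul_eq_mul]
  field_simp

lemma fej_integral_pos : 0 < ∫ z, fej 1 z := by
  refine (integral_pos_iff_support_of_nonneg (fun z => fej_nonneg one_pos z)
    (fej_integrable one_pos)).2 ?_
  have : IsOpen (Function.support (fej 1)) := (fej_cont 1).isOpen_support
  exact this.measure_pos volume ⟨0, by simp [fej_zero one_pos]⟩

/-! ### kernel K -/

lemma symP_integral {σ : ℝ} (hσ : 0 < σ) (t z : ℝ) :
    ∫ u in Ioi (0:ℝ), Real.exp (-σ * u) * Real.cos (t * (z - u)) = symP σ t z := by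
  have hden : σ ^ 2 + t ^ 2 ≠ 0 := by positivity
  have hd : ∀ u ∈ Ici (0:ℝ), HasDerivAt
      (fun u => - (Real.exp (-σ * u) * symP σ t (z - u)))
      (Real.exp (-σ * u) * Real.cos (t * (z - u))) u := by
    intro u _
    unfold symP
    have h1 : HasDerivAt (fun u : ℝ => t * (z - u)) (-t) u := by
      simpa using ((hasDerivAt_id u).const_sub z).const_mul t
    have h2 : HasDerivAt (fun u : ℝ => -σ * u) (-σ) u := by
      simpa using (hasDerivAt_id u).const_mul (-σ)
    have h3 := (h2.exp.mul (((h1.cos.const_mul σ).add (h1.sin.const_mul t)).div_const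
      (σ ^ 2 + t ^ 2))).neg
    refine h3.congr_deriv ?_
    simp only [Pi.add_apply]
    field_simp
    ring
  have hexp : IntegrableOn (fun u => Real.exp (-σ * u)) (Ioi (0:ℝ)) :=
    integrableOn_exp_mul_Ioi (by linarith) 0
  have hInt : IntegrableOn (fun u => Real.exp (-σ * u) * Real.cos (t * (z - u))) (Ioi (0:ℝ)) := by
    refine Integrable.mono' hexp (Continuous.aestronglyMeasurable (by fun_prop)) ?_
    refine Eventually.of_forall fun u => ?_
    rw [norm_mul, Real.norm_of_nonneg (Real.exp_pos _).le]
    exact mul_le_of_le_one_right (Real.exp_pos _).le (Real.abs_cos_le_one _)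
  have hlim : Tendsto (fun u => - (Real.exp (-σ * u) * symP σ t (z - u))) atTop (nhds 0) := by
    rw [← neg_zero]
    apply Tendsto.neg
    have he : Tendsto (fun u : ℝ => Real.exp (-σ * u)) atTop (nhds 0) := by
      apply Real.tendsto_exp_atBot.comp
      exact (tendsto_const_mul_atBot_of_neg (by linarith)).2 tendsto_id
    refine he.zero_mul_isBoundedUnder_le ?_
    refine isBoundedUnder_of ⟨(σ + |t|) / (σ ^ 2 + t ^ 2), fun u => ?_⟩
    simp only [Function.comp, symP]
    rw [norm_div, Real.norm_of_nonneg (by positivity : 0 ≤ σ ^ 2 + t ^ 2)]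
    gcongr
    refine (norm_add_le _ _).trans ?_
    rw [norm_mul, norm_mul, Real.norm_of_nonneg hσ.le]
    exact add_le_add (mul_le_of_le_one_right hσ.le (Real.abs_cos_le_one _))
      (mul_le_of_le_one_right (abs_nonneg _) (Real.abs_sin_le_one _))
  rw [integral_Ioi_of_hasDerivAt_of_tendsto' hd hInt hlim]
  simp

lemma symP_cont {σ : ℝ} (hσ : 0 < σ) : Continuous (fun p : ℝ × ℝ => symP σ p.1 p.2) := by
  unfold symP
  apply Continuous.div (by fun_prop) (by fun_prop)
  intro p; positivity

lemma symP_cont_swap {σ : ℝ} (hσ : 0 < σ) : Continuous (fun p : ℝ × ℝ => symP σ p.2 p.1) := by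
  unfold symP
  apply Continuous.div (by fun_prop) (by fun_prop)
  intro p; positivity

lemma kerK_cont {σ : ℝ} (hσ : 0 < σ) (N : ℝ) : Continuous (kerK σ N) := by
  have h3 : Continuous (fun p : ℝ × ℝ => (1 - p.2 / N)) := by fun_prop
  exact intervalIntegral.continuous_parametric_intervalIntegral_of_continuous'
    (f := fun z t => (1 - t / N) * symP σ t z) (h3.mul (symP_cont_swap hσ)) 0 N

lemma kerK_eq {σ N : ℝ} (hσ : 0 < σ) (hN : 0 < N) (z : ℝ) :
    kerK σ N z = ∫ u in Ioi (0:ℝ), Real.exp (-σ * u) * fej N (z - u) := by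
  unfold kerK fej
  simp_rw [← symP_integral hσ, ← integral_const_mul, ← intervalIntegral.integral_const_mul,
    intervalIntegral.integral_of_le hN.le]
  rw [integral_integral_swap]
  · congr 1; ext u; congr 1; ext t; ring
  · have hexp : IntegrableOn (fun u => Real.exp (-σ * u)) (Ioi (0:ℝ)) :=
      integrableOn_exp_mul_Ioi (by linarith) 0
    have h1 : IntegrableOn (fun t : ℝ => 1 - t / N) (Ioc 0 N) := by
      apply Continuous.integrableOn_Ioc; fun_prop
    have h2 := Integrable.mul_prod h1 hexp
    refine Integrable.mono h2 (Continuous.aestronglyMeasurable (by unfold Function.uncurry; fun_prop)) ?_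
    refine Eventually.of_forall fun p => ?_
    simp only [Function.uncurry, norm_mul]
    gcongr
    exact mul_le_of_le_one_right (norm_nonneg _) (Real.abs_cos_le_one _)

lemma kerK_integrable {σ N : ℝ} (hσ : 0 < σ) (hN : 0 < N) (z : ℝ) :
    IntegrableOn (fun u => Real.exp (-σ * u) * fej N (z - u)) (Ioi (0:ℝ)) := by
  have hexp : IntegrableOn (fun u => Real.exp (-σ * u)) (Ioi (0:ℝ)) :=
      integrableOn_exp_mul_Ioi (by linarith) 0
  have hf := fej_cont N
  refine Integrable.mono' (hexp.mul_const (N / 2)) (Continuous.aestronglyMeasurable (by fun_prop)) ?_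
  refine Eventually.of_forall fun u => ?_
  rw [norm_mul, Real.norm_of_nonneg (Real.exp_pos _).le, Real.norm_of_nonneg (fej_nonneg hN _)]
  gcongr
  exact fej_le hN _

lemma kerK_nonneg {σ N : ℝ} (hσ : 0 < σ) (hN : 0 < N) (z : ℝ) : 0 ≤ kerK σ N z := by
  rw [kerK_eq hσ hN]
  exact integral_nonneg fun u => mul_nonneg (Real.exp_pos _).le (fej_nonneg hN _)

lemma kerK_bound {σ N : ℝ} (hσ : 1 ≤ σ) (hN : 0 < N) (z : ℝ) :
    kerK σ N z ≤ 32 * (N / 2 + 2 / N) / (1 + z ^ 2) := by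
  have hσ0 : 0 < σ := by linarith
  rw [kerK_eq hσ0 hN]
  set D := N / 2 + 2 / N with hD
  have hDpos : 0 < D := by positivity
  have hexp : IntegrableOn (fun u => Real.exp ((-1/2) * u)) (Ioi (0:ℝ)) :=
      integrableOn_exp_mul_Ioi (by norm_num) 0
  have : ∫ u in Ioi (0:ℝ), (16 * D / (1 + z ^ 2)) * Real.exp ((-1/2) * u)
      = 32 * D / (1 + z ^ 2) := by
    rw [integral_const_mul, integral_exp_mul_Ioi (by norm_num)]
    norm_num
    ring
  rw [← this]
  apply setIntegral_mono_on (kerK_integrable hσ0 hN z) (hexp.const_mul _) measurableSet_Ioi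
  intro u hu
  have hu : 0 < u := hu
  have h1 := fej_bound hN (z - u)
  have h2 : D / (1 + (z - u) ^ 2) ≤ 2 * D * (1 + u ^ 2) / (1 + z ^ 2) := by
    rw [div_le_div_iff₀ (by positivity) (by positivity)]
    have : 1 + z ^ 2 ≤ 2 * (1 + u ^ 2) * (1 + (z - u) ^ 2) := by
      nlinarith [sq_nonneg (z - 2 * u), sq_nonneg (u * (z - u))]
    nlinarith
  have h3 : 1 + u ^ 2 ≤ 8 * Real.exp (u / 2) := by
    have := Real.quadratic_le_exp_of_nonneg (x := u / 2) (by positivity)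
    nlinarith
  have h4 : Real.exp (-σ * u) ≤ Real.exp (-1 * u) := by
    apply Real.exp_le_exp.2; nlinarith
  have h5 : Real.exp (-1 * u) * Real.exp (u / 2) = Real.exp ((-1/2) * u) := by
    rw [← Real.exp_add]; congr 1; ring
  calc Real.exp (-σ * u) * fej N (z - u)
      ≤ Real.exp (-1 * u) * (2 * D * (8 * Real.exp (u / 2)) / (1 + z ^ 2)) := by
        apply mul_le_mul h4 _ (fej_nonneg hN _) (Real.exp_pos _).le
        refine (h1.trans h2).trans ?_
        gcongr
    _ = (16 * D / (1 + z ^ 2)) * (Real.exp (-1 * u) * Real.exp (u / 2)) := by ring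
    _ = _ := by rw [h5]

lemma kerK_lower : ∃ c : ℝ, 0 < c ∧ ∀ σ : ℝ, 1 ≤ σ → σ ≤ 2 → ∀ y : ℝ, 0 ≤ y →
    c / (1 + y ^ 2) ≤ kerK σ 1 y := by
  refine ⟨Real.exp (-16) * (2 * Real.pi) / 128, by positivity, fun σ h1 h2 y hy => ?_⟩
  have hσ0 : 0 < σ := by linarith
  rw [kerK_eq hσ0 one_pos]
  have hpi : 0 < 2 * Real.pi := by positivity
  have hpi8 : 2 * Real.pi ≤ 8 := by linarith [Real.pi_le_four]
  have hf := fej_cont 1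
  calc Real.exp (-16) * (2 * Real.pi) / 128 / (1 + y ^ 2)
      = ∫ u in (0:ℝ)..(2 * Real.pi), Real.exp (-16) / 128 / (1 + y ^ 2) * (1 - Real.cos (y - u)) := by
        rw [intervalIntegral.integral_const_mul, intervalIntegral.integral_sub (by simp)
          (Continuous.intervalIntegrable (by fun_prop) _ _)]
        simp
        ring
    _ ≤ ∫ u in (0:ℝ)..(2 * Real.pi), Real.exp (-σ * u) * fej 1 (y - u) := by
        apply intervalIntegral.integral_mono_on hpi.le
          (Continuous.intervalIntegrable (by fun_prop) _ _)
          (Continuous.intervalIntegrable (by fun_prop) _ _)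
        intro u hu
        have hu0 := hu.1
        have hu8 : u ≤ 8 := hu.2.trans hpi8
        have e1 : Real.exp (-16) ≤ Real.exp (-σ * u) := by
          apply Real.exp_le_exp.2; nlinarith
        have e2 : (1 - Real.cos (y - u)) / (128 * (1 + y ^ 2)) ≤ fej 1 (y - u) := by
          rw [div_le_iff₀ (by positivity)]
          have := fej_sq_mul one_pos (y - u)
          rw [one_mul, div_one] at this
          rw [← this]
          have h3 := fej_nonneg one_pos (y - u)
          have : (y - u) ^ 2 ≤ 128 * (1 + y ^ 2) := by nlinarith
          nlinarith
        have e3 : 0 ≤ (1 - Real.cos (y - u)) / (128 * (1 + y ^ 2)) :=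
          div_nonneg (by linarith [Real.cos_le_one (y - u)]) (by positivity)
        calc _ = Real.exp (-16) * ((1 - Real.cos (y - u)) / (128 * (1 + y ^ 2))) := by
              field_simp
          _ ≤ _ := mul_le_mul e1 e2 e3 (Real.exp_pos _).le
    _ ≤ _ := by
        rw [intervalIntegral.integral_of_le hpi.le]
        apply setIntegral_mono_set (kerK_integrable hσ0 one_pos y)
        · exact Eventually.of_forall fun u => mul_nonneg (Real.exp_pos _).le (fej_nonneg one_pos _)
        · exact (Ioc_subset_Ioi_self).eventuallyLE

lemma symP_abs_le {σ t : ℝ} (hσ : 1 ≤ σ) (z : ℝ) : |symP σ t z| ≤ 2 := by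
  unfold symP
  have hp : 0 < σ ^ 2 + t ^ 2 := by positivity
  rw [abs_div, abs_of_pos hp, div_le_iff₀ hp]
  have h1 := Real.abs_cos_le_one (t * z)
  have h2 := Real.abs_sin_le_one (t * z)
  calc _ ≤ |σ * Real.cos (t * z)| + |t * Real.sin (t * z)| := abs_add_le _ _
    _ ≤ σ + |t| := by
      rw [abs_mul, abs_mul, abs_of_pos (by linarith : 0 < σ)]
      exact add_le_add (mul_le_of_le_one_right (by linarith) h1)
        (mul_le_of_le_one_right (abs_nonneg _) h2)
    _ ≤ _ := by nlinarith [sq_nonneg (|t| - 1), sq_abs t]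

lemma kerK_tendsto {N : ℝ} (hN : 0 < N) (z : ℝ) {s : ℕ → ℝ} (hs : ∀ n, 1 < s n)
    (hs1 : Tendsto s atTop (nhds 1)) :
    Tendsto (fun n => kerK (s n) N z) atTop (nhds (kerK 1 N z)) := by
  unfold kerK
  apply intervalIntegral.tendsto_integral_filter_of_dominated_convergence (fun _ => 2)
  · refine Eventually.of_forall fun n => Continuous.aestronglyMeasurable ?_
    have := (symP_cont (by linarith [hs n] : 0 < s n)).comp
      (continuous_id.prodMk (continuous_const (y := z)))
    exact Continuous.mul (by fun_prop) this
  · refine Eventually.of_forall fun n => Eventually.of_forall fun t ht => ?_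
    rw [uIoc_of_le hN.le] at ht
    have h0 : 0 ≤ 1 - t / N := by rw [sub_nonneg, div_le_one hN]; exact ht.2
    have h1 : 1 - t / N ≤ 1 := by linarith [div_nonneg ht.1.le hN.le]
    rw [norm_mul, Real.norm_of_nonneg h0]
    have := symP_abs_le (hs n).le (t := t) z
    rw [Real.norm_eq_abs]
    nlinarith [abs_nonneg (symP (s n) t z)]
  · simp
  · refine Eventually.of_forall fun t ht => Tendsto.const_mul _ ?_
    unfold symP
    apply Tendsto.div
    · exact (hs1.mul_const _).add_const _
    · exact (hs1.pow 2).add_const _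
    · positivity

/-- the product identity -/
lemma kernel_identity {σ N : ℝ} (hσ : 0 < σ) (x y : ℝ) :
    ∫ t in (0:ℝ)..N, (σ * Real.cos (t * y) + t * Real.sin (t * y)) * ((1 - t / N) * symP σ t x)
      = (fej N (x - y) - fej N (x + y) + 2 * σ * kerK σ N (x + y)) / 2 := by
  unfold fej kerK
  have hc : ∀ z, Continuous (fun t => (1 - t / N) * symP σ t z) := by
    intro z
    have := (symP_cont hσ).comp (continuous_id.prodMk (continuous_const (y := z)))
    exact Continuous.mul (by fun_prop) this
  rw [← intervalIntegral.integral_const_mul, ← intervalIntegral.integral_sub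
      (Continuous.intervalIntegrable (by fun_prop) _ _)
      (Continuous.intervalIntegrable (by fun_prop) _ _),
      ← intervalIntegral.integral_add (Continuous.intervalIntegrable (by fun_prop) _ _)
      (((hc (x + y)).intervalIntegrable _ _).const_mul (2 * σ)),
      ← intervalIntegral.integral_div]
  congr 1
  ext t
  unfold symP
  have hden : σ ^ 2 + t ^ 2 ≠ 0 := by positivity
  rw [mul_sub t x y, mul_add t x y, Real.cos_sub, Real.cos_add, Real.sin_add]
  field_simp
  ring

/-! ### Laplace representation -/

lemma meas_mono (μ : Measure ℝ) [IsLocallyFiniteMeasure μ] :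
    Monotone (fun y => (μ (Icc 0 y)).toReal) := by
  intro a b hab
  exact ENNReal.toReal_mono (isCompact_Icc.measure_lt_top.ne)
    (measure_mono (Icc_subset_Icc_right hab))

lemma meas_growth (μ : Measure ℝ) [IsLocallyFiniteMeasure μ]
    (hconv : ∀ s : ℂ, 1 < s.re → Integrable (fun x : ℝ => Complex.exp (-s * x)) μ)
    (σ : ℝ) (hσ : 1 < σ) : ∃ C : ℝ, 0 ≤ C ∧ ∀ y, (μ (Icc 0 y)).toReal ≤ C * Real.exp (σ * y) := by
  have h := (hconv σ (by simpa using hσ)).norm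
  have h' : Integrable (fun x : ℝ => Real.exp (-σ * x)) μ := by
    refine h.congr (Eventually.of_forall fun x => ?_)
    simp [Complex.norm_exp]
  refine ⟨∫ x, Real.exp (-σ * x) ∂μ, integral_nonneg fun x => (Real.exp_pos _).le, fun y => ?_⟩
  have h1 : ∫ x in Icc 0 y, Real.exp (-σ * y) ∂μ ≤ ∫ x in Icc 0 y, Real.exp (-σ * x) ∂μ := by
    apply setIntegral_mono_on _ h'.integrableOn measurableSet_Icc
    · intro x hx
      apply Real.exp_le_exp.2
      nlinarith [hx.2]
    · exact integrableOn_const (isCompact_Icc.measure_lt_top.ne)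
  have h2 : ∫ x in Icc 0 y, Real.exp (-σ * x) ∂μ ≤ ∫ x, Real.exp (-σ * x) ∂μ :=
    setIntegral_le_integral h' (Eventually.of_forall fun x => (Real.exp_pos _).le)
  rw [setIntegral_const, smul_eq_mul, measureReal_def] at h1
  have h3 := h1.trans h2
  have h4 : Real.exp (-σ * y) * Real.exp (σ * y) = 1 := by
    rw [← Real.exp_add]; simp
  have h5 := mul_le_mul_of_nonneg_right h3 (Real.exp_pos (σ * y)).le
  rwa [mul_assoc, h4, mul_one] at h5

lemma meas_exp_integrable (μ : Measure ℝ) [IsLocallyFiniteMeasure μ]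
    (hconv : ∀ s : ℂ, 1 < s.re → Integrable (fun x : ℝ => Complex.exp (-s * x)) μ)
    (σ : ℝ) (hσ : 1 < σ) :
    IntegrableOn (fun y => Real.exp (-σ * y) * (μ (Icc 0 y)).toReal) (Ioi 0) := by
  obtain ⟨C, hC, hb⟩ := meas_growth μ hconv ((1 + σ) / 2) (by linarith)
  have hexp : IntegrableOn (fun u => Real.exp (((1 - σ) / 2) * u)) (Ioi (0:ℝ)) :=
      integrableOn_exp_mul_Ioi (by linarith) 0
  refine Integrable.mono' (hexp.const_mul C) ?_ (Eventually.of_forall fun y => ?_)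
  · exact (Measurable.mul (by fun_prop) (meas_mono μ).measurable).aestronglyMeasurable
  · rw [norm_mul, Real.norm_of_nonneg (Real.exp_pos _).le, Real.norm_of_nonneg ENNReal.toReal_nonneg]
    calc _ ≤ Real.exp (-σ * y) * (C * Real.exp ((1 + σ) / 2 * y)) := by
          gcongr; exact hb y
      _ = C * (Real.exp (-σ * y) * Real.exp ((1 + σ) / 2 * y)) := by ring
      _ = _ := by rw [← Real.exp_add]; congr 2; ring

lemma exp_Ioi {s : ℂ} (hs : 0 < s.re) (x : ℝ) :
    ∫ y in Ioi x, s * Complex.exp (-s * y) = Complex.exp (-s * x) := by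
  have hs0 : s ≠ 0 := by rintro rfl; simp at hs
  rw [integral_const_mul, integral_exp_mul_complex_Ioi (by simpa using hs)]
  field_simp

lemma laplace_rep (μ : Measure ℝ) [IsLocallyFiniteMeasure μ] (hμ : μ (Iio 0) = 0)
    (hconv : ∀ s : ℂ, 1 < s.re → Integrable (fun x : ℝ => Complex.exp (-s * x)) μ)
    (s : ℂ) (hs : 1 < s.re) :
    ∫ x : ℝ, Complex.exp (-s * x) ∂μ
      = ∫ y in Ioi (0:ℝ), s * Complex.exp (-s * y) * ((μ (Icc 0 y)).toReal : ℂ) := by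
  have hs0 : 0 < s.re := by linarith
  have hae : ∀ᵐ x ∂μ, 0 ≤ x := by
    rw [ae_iff]; simpa [Iio] using hμ
  let g : ℝ → ℝ → ℂ := fun x y => indicator {p : ℝ × ℝ | p.1 ≤ p.2}
    (fun p => s * Complex.exp (-s * p.2)) (x, y)
  have hgm : Measurable (Function.uncurry g) := by
    have : MeasurableSet {p : ℝ × ℝ | p.1 ≤ p.2} := measurableSet_le measurable_fst measurable_snd
    exact Measurable.indicator (by fun_prop) this
  have hg1 : ∀ x y, g x y = indicator (Ici x) (fun y : ℝ => s * Complex.exp (-s * y)) y := by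
    intro x y; simp [g, indicator]
  have hinner : ∀ x : ℝ, 0 ≤ x → ∀ F : ℝ → ℝ, ∫ y in Ioi (0:ℝ), indicator (Ici x) F y
      = ∫ y in Ioi x, F y := by
    intro x hx F
    rw [setIntegral_indicator measurableSet_Ici]
    apply setIntegral_congr_set
    rcases hx.eq_or_lt with h | h
    · rw [← h, inter_eq_left.2 Ioi_subset_Ici_self]; exact EventuallyEq.rfl
    · rw [inter_eq_right.2 (Ici_subset_Ioi.2 h)]
      exact Ioi_ae_eq_Ici.symm
  have hinnerC : ∀ x : ℝ, 0 ≤ x → ∀ F : ℝ → ℂ, ∫ y in Ioi (0:ℝ), indicator (Ici x) F y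
      = ∫ y in Ioi x, F y := by
    intro x hx F
    rw [setIntegral_indicator measurableSet_Ici]
    apply setIntegral_congr_set
    rcases hx.eq_or_lt with h | h
    · rw [← h, inter_eq_left.2 Ioi_subset_Ici_self]; exact EventuallyEq.rfl
    · rw [inter_eq_right.2 (Ici_subset_Ioi.2 h)]
      exact Ioi_ae_eq_Ici.symm
  have hexpI : ∀ x : ℝ, IntegrableOn (fun y : ℝ => s * Complex.exp (-s * y)) (Ioi x) := by
    intro x
    exact (integrableOn_exp_mul_complex_Ioi (by simpa using hs0) x).const_mul s
  have hInt : Integrable (Function.uncurry g) (μ.prod (volume.restrict (Ioi 0))) := by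
    rw [integrable_prod_iff hgm.aestronglyMeasurable]
    constructor
    · refine Eventually.of_forall fun x => ?_
      simp only [Function.uncurry, hg1]
      exact (hexpI 0).indicator measurableSet_Ici
    · have h1 : Integrable (fun x : ℝ => ‖s‖ / s.re * ‖Complex.exp (-s * x)‖) μ :=
        (hconv s hs).norm.const_mul _
      refine h1.congr ?_
      filter_upwards [hae] with x hx
      simp only [Function.uncurry, hg1, norm_indicator_eq_indicator_norm]
      rw [hinner x hx]
      simp only [norm_mul, Complex.norm_exp]
      rw [integral_const_mul]
      simp only [Complex.mul_re, Complex.neg_re, Complex.ofReal_re, Complex.ofReal_im, mul_zero,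
        sub_zero]
      rw [integral_exp_mul_Ioi (by linarith)]
      field_simp
  have hsw := integral_integral_swap hInt
  have hL : ∫ x, (∫ y in Ioi (0:ℝ), g x y) ∂μ = ∫ x : ℝ, Complex.exp (-s * x) ∂μ := by
    apply integral_congr_ae
    filter_upwards [hae] with x hx
    simp only [hg1]
    rw [hinnerC x hx, exp_Ioi hs0]
  rw [← hL, hsw]
  congr 1
  ext y
  have : (fun x => g x y) = indicator (Iic y) (fun _ => s * Complex.exp (-s * y)) := by
    ext x; simp [g, indicator]
  rw [this, integral_indicator measurableSet_Iic, setIntegral_const, Complex.real_smul, mul_comm]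
  congr 2
  rw [measureReal_def]
  congr 1
  apply measure_congr
  filter_upwards [hae] with x hx
  apply propext
  exact ⟨fun h => ⟨hx, h⟩, fun h => h.2⟩

lemma lap_diff (μ : Measure ℝ)
    (hconv : ∀ s : ℂ, 1 < s.re → Integrable (fun x : ℝ => Complex.exp (-s * x)) μ) :
    DifferentiableOn ℂ (fun s => ∫ x : ℝ, Complex.exp (-s * x) ∂μ) {s | 1 < s.re} := by
  have h := ProbabilityTheory.differentiableOn_complexMGF (X := (id : ℝ → ℝ)) (μ := μ)
  have h2 : (fun s => ∫ x : ℝ, Complex.exp (-s * x) ∂μ)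
      = (ProbabilityTheory.complexMGF (id : ℝ → ℝ) μ) ∘ (fun s => -s) := by
    ext s; simp [ProbabilityTheory.complexMGF]
  rw [h2]
  refine h.comp (by fun_prop) ?_
  intro s hs
  have hs : 1 < s.re := hs
  have hsub : Iio (-1:ℝ) ⊆ ProbabilityTheory.integrableExpSet (id : ℝ → ℝ) μ := by
    intro t ht
    have ht : t < -1 := ht
    have := (hconv ((-t : ℝ) : ℂ) (by simp; linarith)).norm
    refine this.congr (Eventually.of_forall fun x => ?_)
    simp [Complex.norm_exp]
  have := interior_mono hsub
  rw [interior_Iio] at this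
  apply this
  simp; linarith

lemma U_formula (μp μm : Measure ℝ)
    [IsLocallyFiniteMeasure μp] [IsLocallyFiniteMeasure μm]
    (hμp : μp (Iio 0) = 0) (hμm : μm (Iio 0) = 0)
    (hconv : ∀ s : ℂ, 1 < s.re →
      Integrable (fun x : ℝ => Complex.exp (-s * x)) μp ∧
      Integrable (fun x : ℝ => Complex.exp (-s * x)) μm)
    (S : ℝ → ℝ) (hSdef : ∀ x : ℝ, S x = (μp (Icc 0 x)).toReal - (μm (Icc 0 x)).toReal)
    (σ t : ℝ) (hσ : 1 < σ) :
    (laplaceStieltjes μp μm (σ + t * Complex.I)).re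
      = ∫ y in Ioi (0:ℝ), (Real.exp (-σ * y) * S y) *
        (σ * Real.cos (t * y) + t * Real.sin (t * y)) := by
  have hre : (σ + t * Complex.I : ℂ).re = σ := by simp
  have key : ∀ (μ : Measure ℝ) [IsLocallyFiniteMeasure μ], μ (Iio 0) = 0 →
      (∀ s : ℂ, 1 < s.re → Integrable (fun x : ℝ => Complex.exp (-s * x)) μ) →
      (∫ x : ℝ, Complex.exp (-(σ + t * Complex.I) * x) ∂μ).re = 
      ∫ y in Ioi (0:ℝ), (Real.exp (-σ * y) * (μ (Icc 0 y)).toReal) *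
        (σ * Real.cos (t * y) + t * Real.sin (t * y)) := by
    intro μ _ h0 hc
    rw [laplace_rep μ h0 hc _ (by rw [hre]; exact hσ)]
    have hI : IntegrableOn (fun y : ℝ => (σ + t * Complex.I) * Complex.exp (-(σ + t * Complex.I) * y) * ((μ (Icc 0 y)).toReal : ℂ)) (Ioi 0) := by
      refine Integrable.mono ((meas_exp_integrable μ hc σ hσ).const_mul ‖(σ + t * Complex.I : ℂ)‖) ?_ ?_
      · refine (Measurable.mul (by fun_prop) ?_).aestronglyMeasurable
        exact Complex.measurable_ofReal.comp (meas_mono μ).measurable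
      · refine Eventually.of_forall fun y => le_of_eq ?_
        simp [Complex.norm_exp, mul_assoc]
    have := integral_re (𝕜 := ℂ) hI
    simp only [RCLike.re_eq_complex_re] at this
    rw [← this]
    congr 1
    ext y
    have : Complex.exp (-(σ + t * Complex.I) * y) = (Real.exp (-σ * y) : ℂ) *
        ((Real.cos (t * y) : ℂ) - (Real.sin (t * y) : ℂ) * Complex.I) := by
      have e : -(σ + t * Complex.I) * y = ((-σ * y : ℝ) : ℂ) + ((-(t * y) : ℝ) : ℂ) * Complex.I := by
        push_cast; ring
      rw [e, Complex.exp_add, Complex.exp_mul_I, ← Complex.ofReal_cos, ← Complex.ofReal_sin,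
        Real.cos_neg, Real.sin_neg]
      push_cast; ring
    rw [this]
    simp [-Complex.ofReal_exp, -Complex.ofReal_cos, -Complex.ofReal_sin]
    ring
  unfold laplaceStieltjes
  rw [Complex.sub_re, key μp hμp (fun s hs => (hconv s hs).1), key μm hμm (fun s hs => (hconv s hs).2)]
  have hbI : ∀ (μ : Measure ℝ) [IsLocallyFiniteMeasure μ], 
      (∀ s : ℂ, 1 < s.re → Integrable (fun x : ℝ => Complex.exp (-s * x)) μ) →
      IntegrableOn (fun y => (Real.exp (-σ * y) * (μ (Icc 0 y)).toReal) *
        (σ * Real.cos (t * y) + t * Real.sin (t * y))) (Ioi 0) := by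
    intro μ _ hc
    refine (meas_exp_integrable μ hc σ hσ).mul_bdd (c := |σ| + |t|) (Continuous.aestronglyMeasurable (by fun_prop)) (Eventually.of_forall fun y => ?_)
    refine (norm_add_le _ _).trans ?_
    rw [norm_mul, norm_mul]
    exact add_le_add (mul_le_of_le_one_right (abs_nonneg _) (Real.abs_cos_le_one _))
      (mul_le_of_le_one_right (abs_nonneg _) (Real.abs_sin_le_one _))
  rw [← integral_sub (hbI μp (fun s hs => (hconv s hs).1)) (hbI μm (fun s hs => (hconv s hs).2))]
  congr 1
  ext y
  rw [hSdef]
  ring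

/-! ### Rectangle bound -/

lemma norm_cosh_le (z : ℂ) : ‖Complex.cosh z‖ ≤ Real.exp |z.re| := by
  rw [Complex.cosh, norm_div]
  have h1 : ‖Complex.exp z‖ ≤ Real.exp |z.re| := by
    rw [Complex.norm_exp]; exact Real.exp_le_exp.2 (le_abs_self _)
  have h2 : ‖Complex.exp (-z)‖ ≤ Real.exp |z.re| := by
    rw [Complex.norm_exp]; exact Real.exp_le_exp.2 (by simpa using neg_le_abs _)
  have h3 := norm_add_le (Complex.exp z) (Complex.exp (-z))
  simp only [Complex.norm_ofNat]
  linarith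

lemma rect_identity (F : ℂ → ℂ) (hF : DifferentiableOn ℂ F {s | 1 < s.re}) (l k σ : ℝ)
    (hl : 0 < l) (hk : k * l = Real.pi / 2) (h1 : 1 < σ) (h2 : σ < 2) :
    ∫ t in (-l)..l, (F (σ + t * Complex.I)).re * Real.cos (k * t)
      = (-∫ x in σ..2, ((F (x + (-l : ℝ) * Complex.I)).re + (F (x + l * Complex.I)).re)
          * Real.sinh (k * (x - σ)))
        + (∫ t in (-l)..l, F ((2:ℝ) + t * Complex.I) *
            Complex.cosh (k * ((2:ℝ) + t * Complex.I - σ))).re := by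
  set G : ℂ → ℂ := fun z => F z * Complex.cosh (k * (z - σ)) with hG
  have hGd : DifferentiableOn ℂ G {s | 1 < s.re} := hF.mul (by fun_prop)
  have hrect := Complex.integral_boundary_rect_eq_zero_of_differentiableOn G
    (σ + (-l : ℝ) * Complex.I) ((2:ℝ) + (l:ℝ) * Complex.I) (hGd.mono (by
      intro z hz
      have := hz.1
      simp only [mem_preimage, Complex.add_re, Complex.ofReal_re, Complex.mul_re, Complex.I_re,
        mul_zero, Complex.ofReal_im, Complex.I_im, mul_one, sub_self, add_zero] at this
      rw [uIcc_of_le h2.le] at this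
      exact lt_of_lt_of_le h1 this.1))
  simp only [Complex.add_re, Complex.ofReal_re, Complex.mul_re, Complex.I_re,
        mul_zero, Complex.ofReal_im, Complex.I_im, mul_one, sub_self, add_zero,
        Complex.add_im, Complex.mul_im, zero_add] at hrect
  have hcv : ∀ x : ℝ, 1 < x → Continuous (fun t : ℝ => G (x + t * Complex.I)) := by
    intro x hx
    exact hGd.continuousOn.comp_continuous (by fun_prop) (fun t => by simpa using hx)
  have hch : ∀ t : ℝ, ContinuousOn (fun x : ℝ => G (x + t * Complex.I)) (uIcc σ 2) := by
    intro t
    refine hGd.continuousOn.comp (by fun_prop) (fun x hx => ?_)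
    rw [uIcc_of_le h2.le] at hx
    simpa using lt_of_lt_of_le h1 hx.1
  have hI := congrArg Complex.im hrect
  simp only [Complex.sub_im, Complex.add_im, smul_eq_mul, Complex.mul_im, Complex.I_re,
    Complex.I_im, zero_mul, one_mul, zero_add, Complex.zero_im] at hI
  have him : ∀ t : ℝ, (∫ x in σ..2, G (x + t * Complex.I)).im
      = ∫ x in σ..2, (G (x + t * Complex.I)).im := by
    intro t
    exact (Complex.imCLM.intervalIntegral_comp_comm ((hch t).intervalIntegrable)).symm
  have hre : (∫ t in (-l)..l, G (σ + t * Complex.I)).re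
      = ∫ t in (-l)..l, (G (σ + t * Complex.I)).re :=
    (Complex.reCLM.intervalIntegral_comp_comm ((hcv σ h1).intervalIntegrable _ _)).symm
  rw [him, him, hre] at hI
  have e1 : ∀ t : ℝ, (G (σ + t * Complex.I)).re = (F (σ + t * Complex.I)).re * Real.cos (k * t) := by
    intro t
    have : (k : ℂ) * (σ + t * Complex.I - σ) = ((k * t : ℝ) : ℂ) * Complex.I := by
      push_cast; ring
    simp only [hG]
    rw [this, Complex.cosh_mul_I, ← Complex.ofReal_cos]
    simp [-Complex.ofReal_cos]
  have e2 : ∀ x : ℝ, (G (x + l * Complex.I)).im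
      = (F (x + l * Complex.I)).re * Real.sinh (k * (x - σ)) := by
    intro x
    have : (k : ℂ) * (x + l * Complex.I - σ)
        = ((k * (x - σ) : ℝ) : ℂ) + ((k * l : ℝ) : ℂ) * Complex.I := by
      push_cast; ring
    simp only [hG]
    rw [this, Complex.cosh_add, Complex.cosh_mul_I, Complex.sinh_mul_I, ← Complex.ofReal_cos,
      ← Complex.ofReal_sin, hk, Real.cos_pi_div_two, Real.sin_pi_div_two, ← Complex.ofReal_sinh]
    simp [-Complex.ofReal_sinh]
  have e3 : ∀ x : ℝ, (G (x + (-l:ℝ) * Complex.I)).im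
      = -((F (x + (-l:ℝ) * Complex.I)).re * Real.sinh (k * (x - σ))) := by
    intro x
    have : (k : ℂ) * (x + (-l:ℝ) * Complex.I - σ)
        = ((k * (x - σ) : ℝ) : ℂ) + ((-(k * l) : ℝ) : ℂ) * Complex.I := by
      push_cast; ring
    simp only [hG]
    rw [this, Complex.cosh_add, Complex.cosh_mul_I, Complex.sinh_mul_I, ← Complex.ofReal_cos,
      ← Complex.ofReal_sin, hk, Real.cos_neg, Real.sin_neg, Real.cos_pi_div_two,
      Real.sin_pi_div_two, ← Complex.ofReal_sinh]
    simp [-Complex.ofReal_sinh]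
  simp only [e1, e2, e3] at hI
  have hcF : ∀ t : ℝ, ContinuousOn (fun x : ℝ => (F (x + t * Complex.I)).re) (uIcc σ 2) := by
    intro t
    refine Complex.continuous_re.comp_continuousOn (hF.continuousOn.comp (by fun_prop) (fun x hx => ?_))
    rw [uIcc_of_le h2.le] at hx
    simpa using lt_of_lt_of_le h1 hx.1
  simp only [add_mul]
  have hiF : ∀ t : ℝ, IntervalIntegrable
      (fun x : ℝ => (F (x + t * Complex.I)).re * Real.sinh (k * (x - σ))) volume σ 2 := fun t =>
    ((hcF t).mul (Continuous.continuousOn (by fun_prop))).intervalIntegrable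
  rw [intervalIntegral.integral_add (hiF (-l)) (hiF l)]
  rw [intervalIntegral.integral_neg] at hI
  simp only [hG] at hI
  linarith

lemma rect_bound (F : ℂ → ℂ) (hF : DifferentiableOn ℂ F {s | 1 < s.re}) (lam : ℝ)
    (hlam : 0 < lam) (c : ℝ) (hc : 0 ≤ c)
    (hlow : ∀ t ∈ Ioo (-lam) lam, ∀ σ ∈ Ioc (1 : ℝ) 2, -c ≤ (F (σ + t * Complex.I)).re) :
    ∃ δ M : ℝ, 0 < δ ∧ ∀ σ : ℝ, 1 < σ → σ < 2 →
      ∫ t in (0:ℝ)..δ, |(F (σ + t * Complex.I)).re| ≤ M := by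
  set l := lam / 2 with hl
  set k := Real.pi / lam with hk
  have hlpos : 0 < l := by positivity
  have hkpos : 0 < k := by positivity
  have hkl : k * l = Real.pi / 2 := by rw [hk, hl]; field_simp
  set B : ℝ := 2 * c * Real.sinh k
    + Real.exp k * ∫ t in (-l)..l, ‖F ((2:ℝ) + t * Complex.I)‖ with hB
  refine ⟨lam / 3, 2 * (B + c * (2 * l)) + c * (lam / 3), by positivity, fun σ h1 h2 => ?_⟩
  have hcv : ∀ x : ℝ, 1 < x → Continuous (fun t : ℝ => F (x + t * Complex.I)) := by
    intro x hx
    exact hF.continuousOn.comp_continuous (by fun_prop) (fun t => by simpa using hx)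
  have hcu : Continuous (fun t : ℝ => (F (σ + t * Complex.I)).re) :=
    Complex.continuous_re.comp (hcv σ h1)
  have hid := rect_identity F hF l k σ hlpos hkl h1 h2
  have hright : (∫ t in (-l)..l, F ((2:ℝ) + t * Complex.I) *
            Complex.cosh (k * ((2:ℝ) + t * Complex.I - σ))).re
      ≤ Real.exp k * ∫ t in (-l)..l, ‖F ((2:ℝ) + t * Complex.I)‖ := by
    refine (Complex.re_le_norm _).trans ?_
    refine (intervalIntegral.norm_integral_le_integral_norm (by linarith)).trans ?_
    rw [← intervalIntegral.integral_const_mul]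
    have hc2 := hcv 2 (by norm_num)
    apply intervalIntegral.integral_mono_on (by linarith)
    · exact Continuous.intervalIntegrable (hc2.mul (by fun_prop)).norm _ _
    · exact Continuous.intervalIntegrable (continuous_const.mul hc2.norm) _ _
    · intro t _
      rw [norm_mul, mul_comm]
      gcongr
      refine (norm_cosh_le _).trans (Real.exp_le_exp.2 ?_)
      simp only [Complex.mul_re, Complex.sub_re, Complex.add_re, Complex.ofReal_re, Complex.I_re,
        mul_zero, Complex.ofReal_im, Complex.I_im, mul_one, sub_self, add_zero, zero_mul, sub_zero]
      rw [abs_of_nonneg (mul_nonneg hkpos.le (by linarith))]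
      nlinarith
  have hcF : ∀ t : ℝ, ContinuousOn (fun x : ℝ => (F (x + t * Complex.I)).re) (uIcc σ 2) := by
    intro t
    refine Complex.continuous_re.comp_continuousOn (hF.continuousOn.comp (by fun_prop) (fun x hx => ?_))
    rw [uIcc_of_le h2.le] at hx
    simpa using lt_of_lt_of_le h1 hx.1
  have hside : (-∫ x in σ..2, ((F (x + (-l : ℝ) * Complex.I)).re + (F (x + l * Complex.I)).re)
          * Real.sinh (k * (x - σ))) ≤ 2 * c * Real.sinh k := by
    rw [← intervalIntegral.integral_neg]
    calc _ ≤ ∫ x in σ..2, 2 * c * Real.sinh k := by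
          apply intervalIntegral.integral_mono_on h2.le
          · exact (((hcF (-l)).add (hcF l)).mul
              (Continuous.continuousOn (by fun_prop))).neg.intervalIntegrable
          · simp
          · intro x hx
            have u1 := hlow (-l) ⟨by linarith, by linarith⟩ x ⟨by linarith [hx.1], hx.2⟩
            have u2 := hlow l ⟨by linarith, by linarith⟩ x ⟨by linarith [hx.1], hx.2⟩
            have s0 : 0 ≤ Real.sinh (k * (x - σ)) :=
              Real.sinh_nonneg_iff.2 (mul_nonneg hkpos.le (by linarith [hx.1]))
            have s1 : Real.sinh (k * (x - σ)) ≤ Real.sinh k := by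
              apply Real.sinh_le_sinh.2
              nlinarith [hx.2]
            nlinarith
      _ ≤ _ := by
          rw [intervalIntegral.integral_const, smul_eq_mul]
          have : 0 ≤ 2 * c * Real.sinh k :=
            mul_nonneg (by linarith) (Real.sinh_nonneg_iff.2 hkpos.le)
          nlinarith
  have hcos : ∀ t ∈ Icc (-l) l, 0 ≤ Real.cos (k * t) := by
    intro t ht
    apply Real.cos_nonneg_of_neg_pi_div_two_le_of_le
    · nlinarith [ht.1]
    · nlinarith [ht.2]
  have hmain : ∫ t in (-l)..l, ((F (σ + t * Complex.I)).re + c) * Real.cos (k * t)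
      ≤ B + c * (2 * l) := by
    simp only [add_mul]
    rw [intervalIntegral.integral_add (Continuous.intervalIntegrable (by fun_prop) _ _)
      (Continuous.intervalIntegrable (by fun_prop) _ _), hid]
    have : ∫ t in (-l)..l, c * Real.cos (k * t) ≤ ∫ t in (-l)..l, c := by
      apply intervalIntegral.integral_mono_on (by linarith)
        (Continuous.intervalIntegrable (by fun_prop) _ _) (by simp)
      intro t _
      exact mul_le_of_le_one_right hc (Real.cos_le_one _)
    rw [intervalIntegral.integral_const, smul_eq_mul] at this
    linarith
  have hsub : ∫ t in (0:ℝ)..(lam / 3), ((F (σ + t * Complex.I)).re + c) * Real.cos (k * t)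
      ≤ ∫ t in (-l)..l, ((F (σ + t * Complex.I)).re + c) * Real.cos (k * t) := by
    apply intervalIntegral.integral_mono_interval (by linarith) (by positivity) (by linarith)
    · rw [Filter.EventuallyLE, ae_restrict_iff' measurableSet_Ioc]
      refine Eventually.of_forall fun t ht => ?_
      have := hlow t ⟨by linarith [ht.1], by linarith [ht.2]⟩ σ ⟨h1, h2.le⟩
      exact mul_nonneg (by linarith) (hcos t ⟨ht.1.le, ht.2⟩)
    · exact Continuous.intervalIntegrable (by fun_prop) _ _
  have hlast : ∫ t in (0:ℝ)..(lam / 3), |(F (σ + t * Complex.I)).re|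
      ≤ ∫ t in (0:ℝ)..(lam / 3),
        (2 * (((F (σ + t * Complex.I)).re + c) * Real.cos (k * t)) + c) := by
    apply intervalIntegral.integral_mono_on (by positivity)
      (Continuous.intervalIntegrable (by fun_prop) _ _)
      (Continuous.intervalIntegrable (by fun_prop) _ _)
    intro t ht
    have := hlow t ⟨by linarith [ht.1], by linarith [ht.2]⟩ σ ⟨h1, h2.le⟩
    have hct : 1 / 2 ≤ Real.cos (k * t) := by
      rw [← Real.cos_pi_div_three]
      apply Real.cos_le_cos_of_nonneg_of_le_pi
      · exact mul_nonneg hkpos.le ht.1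
      · linarith [Real.pi_pos]
      · calc k * t ≤ k * (lam / 3) := by gcongr; exact ht.2
          _ = _ := by rw [hk]; field_simp
    rw [abs_le]
    constructor <;> nlinarith
  rw [intervalIntegral.integral_add (Continuous.intervalIntegrable (by fun_prop) _ _) (by simp),
    intervalIntegral.integral_const_mul, intervalIntegral.integral_const, smul_eq_mul] at hlast
  linarith

/-! ### Weak convergence of boundary values -/

lemma f_integrable (u : ℝ → ℝ → ℝ) (f : ℝ → ℝ) (hu : ∀ σ, 1 < σ → Continuous (u σ))
    (δ M : ℝ) (hδ : 0 < δ) (hM : ∀ σ, 1 < σ → σ < 2 → ∫ t in (0:ℝ)..δ, |u σ t| ≤ M)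
    (hf : ∀ a b, 0 < a → a ≤ b → IntegrableOn f (Icc a b) ∧
      Tendsto (fun σ => ∫ t in a..b, |u σ t - f t|) (nhdsWithin 1 (Ioi 1)) (nhds 0))
    (R : ℝ) : IntegrableOn f (Ioc 0 R) := by
  have h1 : IntegrableOn f (Ioc 0 δ) := by
    have ha : Tendsto (fun n : ℕ => δ * (1 / ((n:ℝ) + 1))) atTop (nhds 0) := by
      simpa using tendsto_one_div_add_atTop_nhds_zero_nat.const_mul δ
    have hpos : ∀ n : ℕ, 0 < δ * (1 / ((n:ℝ) + 1)) := fun n => by positivity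
    have hle : ∀ n : ℕ, δ * (1 / ((n:ℝ) + 1)) ≤ δ := fun n => by
      apply mul_le_of_le_one_right hδ.le
      rw [div_le_one (by positivity)]; linarith [n.cast_nonneg (α := ℝ)]
    have hInt : ∀ n : ℕ, IntegrableOn f (Ioc (δ * (1 / ((n:ℝ) + 1))) δ) := fun n =>
      (hf _ _ (hpos n) (hle n)).1.mono_set Ioc_subset_Icc_self
    refine integrableOn_Ioc_of_intervalIntegral_norm_bounded_left (I := 1 + M) hInt ha
      (Eventually.of_forall fun n => ?_)
    set a := δ * (1 / ((n:ℝ) + 1))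
    have hev := ((hf a δ (hpos n) (hle n)).2.eventually (gt_mem_nhds one_pos)).and
      (Ioo_mem_nhdsGT (show (1:ℝ) < 2 by norm_num))
    obtain ⟨σ, hσ, hσ1, hσ2⟩ := hev.exists
    have hui := (hu σ hσ1)
    have hfi : IntervalIntegrable f volume a δ :=
      (intervalIntegrable_iff_integrableOn_Ioc_of_le (hle n)).2 (hInt n)
    rw [← intervalIntegral.integral_of_le (hle n)]
    calc ∫ t in a..δ, ‖f t‖ ≤ ∫ t in a..δ, (|u σ t - f t| + |u σ t|) := by
          apply intervalIntegral.integral_mono_on (hle n) hfi.norm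
          · exact ((hui.intervalIntegrable _ _).sub hfi).abs.add (hui.intervalIntegrable _ _).abs
          · intro t _
            rw [Real.norm_eq_abs]
            have := abs_sub_abs_le_abs_sub (f t) (u σ t)
            rw [abs_sub_comm] at this
            linarith
      _ = (∫ t in a..δ, |u σ t - f t|) + ∫ t in a..δ, |u σ t| :=
          intervalIntegral.integral_add ((hui.intervalIntegrable _ _).sub hfi).abs
            (hui.intervalIntegrable _ _).abs
      _ ≤ 1 + ∫ t in (0:ℝ)..δ, |u σ t| := by
          apply add_le_add hσ.le
          exact intervalIntegral.integral_mono_interval (hpos n).le (hle n) le_rfl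
            (Eventually.of_forall fun t => abs_nonneg _) (hui.abs.intervalIntegrable _ _)
      _ ≤ 1 + M := by linarith [hM σ hσ1 hσ2]
  by_cases hR : R ≤ δ
  · exact h1.mono_set (Ioc_subset_Ioc_right hR)
  · push Not at hR
    have h2 := (hf δ R hδ hR.le).1
    refine (h1.union h2).mono_set ?_
    intro t ht
    by_cases htd : t ≤ δ
    · exact Or.inl ⟨ht.1, htd⟩
    · exact Or.inr ⟨(not_le.1 htd).le, ht.2⟩

lemma weak_zero (u : ℝ → ℝ → ℝ) (f : ℝ → ℝ) (hu : ∀ σ, 1 < σ → Continuous (u σ))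
    (δ M : ℝ) (hδ : 0 < δ) (hM : ∀ σ, 1 < σ → σ < 2 → ∫ t in (0:ℝ)..δ, |u σ t| ≤ M)
    (hf : ∀ a b, 0 < a → a ≤ b → IntegrableOn f (Icc a b) ∧
      Tendsto (fun σ => ∫ t in a..b, |u σ t - f t|) (nhdsWithin 1 (Ioi 1)) (nhds 0))
    (R : ℝ) (hR : 0 < R) (Q : ℝ → ℝ) (hQ : Continuous Q) (hQ0 : Q 0 = 0) :
    Tendsto (fun σ => ∫ t in (0:ℝ)..R, (u σ t - f t) * Q t) (nhdsWithin 1 (Ioi 1)) (nhds 0) := by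
  have hfI := f_integrable u f hu δ M hδ hM hf
  have hfii : ∀ a b, 0 ≤ a → a ≤ b → IntervalIntegrable f volume a b := fun a b ha hab =>
    (intervalIntegrable_iff_integrableOn_Ioc_of_le hab).2
      ((hfI b).mono_set (Ioc_subset_Ioc_left ha))
  have hM0 : 0 ≤ M := by
    refine le_trans ?_ (hM (3/2) (by norm_num) (by norm_num))
    exact intervalIntegral.integral_nonneg hδ.le fun t _ => abs_nonneg _
  have hf0 : 0 ≤ ∫ t in (0:ℝ)..δ, |f t| :=
    intervalIntegral.integral_nonneg hδ.le fun t _ => abs_nonneg _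
  set W := M + (∫ t in (0:ℝ)..δ, |f t|) + 1 with hW
  have hWpos : 0 < W := by linarith
  obtain ⟨B, hB⟩ := (isCompact_Icc (a := (0:ℝ)) (b := R)).exists_bound_of_continuousOn hQ.continuousOn
  have hB0 : 0 ≤ B := (norm_nonneg _).trans (hB 0 ⟨le_rfl, hR.le⟩)
  rw [Metric.tendsto_nhds]
  intro ε hε
  have hQc : ∀ᶠ t in nhds (0:ℝ), |Q t| < ε / (2 * W) := by
    have := hQ.tendsto 0
    rw [hQ0] at this
    have := this.abs
    rw [abs_zero] at this
    exact this.eventually (gt_mem_nhds (by positivity))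
  obtain ⟨η₀, hη₀, hη₀Q⟩ := Metric.eventually_nhds_iff.1 hQc
  set η := min (η₀ / 2) (min δ R) with hη
  have hηpos : 0 < η := lt_min (by positivity) (lt_min hδ hR)
  have hηδ : η ≤ δ := (min_le_right _ _).trans (min_le_left _ _)
  have hηR : η ≤ R := (min_le_right _ _).trans (min_le_right _ _)
  have hQs : ∀ t ∈ Icc 0 η, |Q t| ≤ ε / (2 * W) := by
    intro t ht
    refine (hη₀Q ?_).le
    rw [Real.dist_eq, sub_zero, abs_of_nonneg ht.1]
    have : η ≤ η₀ / 2 := min_le_left _ _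
    linarith [ht.2]
  filter_upwards [(hf η R hηpos hηR).2.eventually
      (gt_mem_nhds (show (0:ℝ) < ε / (2 * (B + 1)) by positivity)),
    Ioo_mem_nhdsGT (show (1:ℝ) < 2 by norm_num)] with σ hσ hσ12
  obtain ⟨hσ1, hσ2⟩ := hσ12
  have hui := hu σ hσ1
  have hd : ∀ a b, 0 ≤ a → a ≤ b → IntervalIntegrable (fun t => u σ t - f t) volume a b :=
    fun a b ha hab => (hui.intervalIntegrable _ _).sub (hfii a b ha hab)
  have hdq : ∀ a b, 0 ≤ a → a ≤ b → IntervalIntegrable (fun t => (u σ t - f t) * Q t) volume a b :=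
    fun a b ha hab => (hd a b ha hab).mul_continuousOn hQ.continuousOn
  rw [Real.dist_eq, sub_zero, ← intervalIntegral.integral_add_adjacent_intervals
    (hdq 0 η le_rfl hηpos.le) (hdq η R hηpos.le hηR)]
  have b1 : |∫ t in (0:ℝ)..η, (u σ t - f t) * Q t| ≤ ε / 2 * ((W - 1) / W) := by
    calc |∫ t in (0:ℝ)..η, (u σ t - f t) * Q t|
        ≤ ∫ t in (0:ℝ)..η, |(u σ t - f t) * Q t| :=
          intervalIntegral.abs_integral_le_integral_abs hηpos.le
      _ ≤ ∫ t in (0:ℝ)..η, (|u σ t| + |f t|) * (ε / (2 * W)) := by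
          apply intervalIntegral.integral_mono_on hηpos.le (hdq 0 η le_rfl hηpos.le).abs
          · exact ((hui.abs.intervalIntegrable _ _).add (hfii 0 η le_rfl hηpos.le).abs).mul_const _
          · intro t ht
            rw [abs_mul]
            exact mul_le_mul (abs_sub _ _) (hQs t ht) (abs_nonneg _) (by positivity)
      _ = (∫ t in (0:ℝ)..η, (|u σ t| + |f t|)) * (ε / (2 * W)) := by
          rw [intervalIntegral.integral_mul_const]
      _ ≤ (∫ t in (0:ℝ)..δ, (|u σ t| + |f t|)) * (ε / (2 * W)) := by
          gcongr
          exact intervalIntegral.integral_mono_interval le_rfl hηpos.le hηδ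
            (Eventually.of_forall fun t => by positivity)
            ((hui.abs.intervalIntegrable _ _).add (hfii 0 δ le_rfl hδ.le).abs)
      _ ≤ (W - 1) * (ε / (2 * W)) := by
          gcongr
          rw [intervalIntegral.integral_add (hui.abs.intervalIntegrable _ _)
            (hfii 0 δ le_rfl hδ.le).abs]
          linarith [hM σ hσ1 hσ2]
      _ = _ := by field_simp
  have b2 : |∫ t in η..R, (u σ t - f t) * Q t| ≤ ε / (2 * (B + 1)) * B := by
    calc |∫ t in η..R, (u σ t - f t) * Q t|
        ≤ ∫ t in η..R, |(u σ t - f t) * Q t| :=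
          intervalIntegral.abs_integral_le_integral_abs hηR
      _ ≤ ∫ t in η..R, |u σ t - f t| * B := by
          apply intervalIntegral.integral_mono_on hηR (hdq η R hηpos.le hηR).abs
          · exact (hd η R hηpos.le hηR).abs.mul_const _
          · intro t ht
            rw [abs_mul]
            gcongr
            exact hB t ⟨hηpos.le.trans ht.1, ht.2⟩
      _ = (∫ t in η..R, |u σ t - f t|) * B := by
          rw [intervalIntegral.integral_mul_const]
      _ ≤ _ := by gcongr
  have b3 : ε / 2 * ((W - 1) / W) < ε / 2 := by
    apply mul_lt_of_lt_one_right (by positivity)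
    rw [div_lt_one hWpos]; linarith
  have b4 : ε / (2 * (B + 1)) * B ≤ ε / 2 := by
    rw [div_mul_eq_mul_div, div_le_div_iff₀ (by positivity) (by positivity)]
    nlinarith
  exact lt_of_le_of_lt (abs_add_le _ _) (by linarith)

lemma weak_seq (u : ℝ → ℝ → ℝ) (f : ℝ → ℝ) (hu : ∀ σ, 1 < σ → Continuous (u σ))
    (δ M : ℝ) (hδ : 0 < δ) (hM : ∀ σ, 1 < σ → σ < 2 → ∫ t in (0:ℝ)..δ, |u σ t| ≤ M)
    (hf : ∀ a b, 0 < a → a ≤ b → IntegrableOn f (Icc a b) ∧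
      Tendsto (fun σ => ∫ t in a..b, |u σ t - f t|) (nhdsWithin 1 (Ioi 1)) (nhds 0)) :
    ∃ (s : ℕ → ℝ) (A : ℝ), (∀ n, 1 < s n) ∧ (∀ n, s n < 2) ∧ Tendsto s atTop (nhds 1) ∧
      ∀ (R : ℝ), 0 < R → ∀ (q : ℝ → ℝ) (qn : ℕ → ℝ → ℝ) (e : ℕ → ℝ), Continuous q →
        (∀ n, Continuous (qn n)) → Tendsto e atTop (nhds 0) →
        (∀ n, ∀ t ∈ Icc 0 R, |qn n t - q t| ≤ e n) →
        Tendsto (fun n => ∫ t in (0:ℝ)..R, u (s n) t * qn n t) atTop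
          (nhds ((∫ t in (0:ℝ)..R, f t * q t) + A * q 0)) := by
  have hfI := f_integrable u f hu δ M hδ hM hf
  have hfii : ∀ a b, 0 ≤ a → a ≤ b → IntervalIntegrable f volume a b := fun a b ha hab =>
    (intervalIntegrable_iff_integrableOn_Ioc_of_le hab).2
      ((hfI b).mono_set (Ioc_subset_Ioc_left ha))
  -- choice of the sequence
  let s₀ : ℕ → ℝ := fun n => 1 + (1 / 2) * (1 / ((n:ℝ) + 1))
  have hs₀1 : ∀ n, 1 < s₀ n := fun n => by
    have : 0 < (1 / 2) * (1 / ((n:ℝ) + 1)) := by positivity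
    simp only [s₀]; linarith
  have hs₀2 : ∀ n, s₀ n < 2 := fun n => by
    have : 1 / ((n:ℝ) + 1) ≤ 1 := by
      rw [div_le_one (by positivity)]; linarith [n.cast_nonneg (α := ℝ)]
    simp only [s₀]; linarith
  have hs₀ : Tendsto s₀ atTop (nhds 1) := by
    have := (tendsto_one_div_add_atTop_nhds_zero_nat (𝕜 := ℝ)).const_mul (1/2)
    simpa [s₀] using this.const_add 1
  have hbd : ∀ n, (∫ t in (0:ℝ)..δ, u (s₀ n) t) ∈ Icc (-M) M := fun n => by
    rw [mem_Icc, ← abs_le]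
    exact (intervalIntegral.abs_integral_le_integral_abs hδ.le).trans
      (hM _ (hs₀1 n) (hs₀2 n))
  obtain ⟨m, _, φ, hφ, hm⟩ := (isCompact_Icc (a := -M) (b := M)).tendsto_subseq hbd
  let s : ℕ → ℝ := s₀ ∘ φ
  have hs1 : ∀ n, 1 < s n := fun n => hs₀1 _
  have hs2 : ∀ n, s n < 2 := fun n => hs₀2 _
  have hs : Tendsto s atTop (nhds 1) := hs₀.comp hφ.tendsto_atTop
  have hsw : Tendsto s atTop (nhdsWithin 1 (Ioi 1)) :=
    tendsto_nhdsWithin_iff.2 ⟨hs, Eventually.of_forall hs1⟩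
  refine ⟨s, m - ∫ t in (0:ℝ)..δ, f t, hs1, hs2, hs, ?_⟩
  intro R hR q qn e hq hqn he heb
  -- convergence of plain integrals on (a,b)
  have hab : ∀ a b, 0 < a → a ≤ b → Tendsto (fun n => ∫ t in a..b, (u (s n) t - f t)) atTop
      (nhds 0) := by
    intro a b ha hab
    refine squeeze_zero_norm (fun n => ?_) ((hf a b ha hab).2.comp hsw)
    exact intervalIntegral.abs_integral_le_integral_abs hab
  have hui : ∀ n a b, IntervalIntegrable (u (s n)) volume a b := fun n a b =>
    (hu _ (hs1 n)).intervalIntegrable _ _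
  have hdi : ∀ n a b, 0 ≤ a → a ≤ b → IntervalIntegrable (fun t => u (s n) t - f t) volume a b :=
    fun n a b ha hab => (hui n a b).sub (hfii a b ha hab)
  have hδlim : Tendsto (fun n => ∫ t in (0:ℝ)..δ, (u (s n) t - f t)) atTop
      (nhds (m - ∫ t in (0:ℝ)..δ, f t)) := by
    have : ∀ n, ∫ t in (0:ℝ)..δ, (u (s n) t - f t)
        = (∫ t in (0:ℝ)..δ, u (s n) t) - ∫ t in (0:ℝ)..δ, f t := fun n =>
      intervalIntegral.integral_sub (hui n _ _) (hfii 0 δ le_rfl hδ.le)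
    simp_rw [this]
    exact hm.sub_const _
  have hRlim : Tendsto (fun n => ∫ t in (0:ℝ)..R, (u (s n) t - f t)) atTop
      (nhds (m - ∫ t in (0:ℝ)..δ, f t)) := by
    rcases le_total δ R with h | h
    · have := hδlim.add (hab δ R hδ h)
      rw [add_zero] at this
      refine this.congr fun n => ?_
      exact intervalIntegral.integral_add_adjacent_intervals (hdi n 0 δ le_rfl hδ.le)
        (hdi n δ R hδ.le h)
    · have := hδlim.sub (hab R δ hR h)
      rw [sub_zero] at this
      refine this.congr fun n => ?_
      rw [← intervalIntegral.integral_add_adjacent_intervals (hdi n 0 R le_rfl hR.le)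
        (hdi n R δ hR.le h)]
      ring
  -- uniform bound
  have hMR : ∃ C, ∀ᶠ n in atTop, ∫ t in (0:ℝ)..R, |u (s n) t| ≤ C := by
    set R' := max R δ
    have h1 : δ ≤ R' := le_max_right _ _
    have h2 : R ≤ R' := le_max_left _ _
    refine ⟨M + (1 + ∫ t in δ..R', |f t|), ?_⟩
    filter_upwards [((hf δ R' hδ h1).2.comp hsw).eventually (gt_mem_nhds one_pos)] with n hn
    calc ∫ t in (0:ℝ)..R, |u (s n) t| ≤ ∫ t in (0:ℝ)..R', |u (s n) t| :=
          intervalIntegral.integral_mono_interval le_rfl hR.le h2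
            (Eventually.of_forall fun t => abs_nonneg _) (hui n _ _).abs
      _ = (∫ t in (0:ℝ)..δ, |u (s n) t|) + ∫ t in δ..R', |u (s n) t| :=
          (intervalIntegral.integral_add_adjacent_intervals (hui n _ _).abs (hui n _ _).abs).symm
      _ ≤ M + ∫ t in δ..R', (|u (s n) t - f t| + |f t|) := by
          apply add_le_add (hM _ (hs1 n) (hs2 n))
          apply intervalIntegral.integral_mono_on h1 (hui n _ _).abs
          · exact (hdi n δ R' hδ.le h1).abs.add (hfii δ R' hδ.le h1).abs
          · intro t _
            have := abs_sub_abs_le_abs_sub (u (s n) t) (f t)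
            linarith
      _ ≤ _ := by
          rw [intervalIntegral.integral_add (hdi n δ R' hδ.le h1).abs (hfii δ R' hδ.le h1).abs]
          have : ∫ t in δ..R', |u (s n) t - f t| < 1 := hn
          linarith
  obtain ⟨C, hC⟩ := hMR
  have h1 : Tendsto (fun n => ∫ t in (0:ℝ)..R, u (s n) t * (qn n t - q t)) atTop (nhds 0) := by
    refine squeeze_zero_norm' (a := fun n => C * |e n|) ?_ ?_
    · filter_upwards [hC] with n hn
      calc ‖∫ t in (0:ℝ)..R, u (s n) t * (qn n t - q t)‖
          ≤ ∫ t in (0:ℝ)..R, |u (s n) t * (qn n t - q t)| :=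
            intervalIntegral.abs_integral_le_integral_abs hR.le
        _ ≤ ∫ t in (0:ℝ)..R, |u (s n) t| * |e n| := by
            apply intervalIntegral.integral_mono_on hR.le
            · exact (((hu _ (hs1 n)).mul ((hqn n).sub hq)).abs).intervalIntegrable _ _
            · exact (hui n _ _).abs.mul_const _
            · intro t ht
              rw [abs_mul]
              exact mul_le_mul_of_nonneg_left ((heb n t ht).trans (le_abs_self _)) (abs_nonneg _)
        _ = (∫ t in (0:ℝ)..R, |u (s n) t|) * |e n| := by
            rw [intervalIntegral.integral_mul_const]
        _ ≤ _ := by gcongr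
    · simpa using (he.abs.const_mul C)
  have h2 := (weak_zero u f hu δ M hδ hM hf R hR (fun t => q t - q 0) (by fun_prop)
    (by simp)).comp hsw
  have h3 := (h1.add h2).add (hRlim.mul_const (q 0))
  have h4 := h3.add_const (∫ t in (0:ℝ)..R, f t * q t)
  rw [add_zero, zero_add, add_comm] at h4
  refine h4.congr fun n => ?_
  have i1 : IntervalIntegrable (fun t => u (s n) t * (qn n t - q t)) volume 0 R :=
    ((hu _ (hs1 n)).mul ((hqn n).sub hq)).intervalIntegrable _ _
  have i2 : IntervalIntegrable (fun t => (u (s n) t - f t) * (q t - q 0)) volume 0 R :=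
    (hdi n 0 R le_rfl hR.le).mul_continuousOn (by fun_prop)
  have i3 : IntervalIntegrable (fun t => (u (s n) t - f t) * q 0) volume 0 R :=
    (hdi n 0 R le_rfl hR.le).mul_const _
  have i4 : IntervalIntegrable (fun t => f t * q t) volume 0 R :=
    (hfii 0 R le_rfl hR.le).mul_continuousOn (by fun_prop)
  simp only [Function.comp]
  rw [← intervalIntegral.integral_mul_const, ← intervalIntegral.integral_add i1 i2,
    ← intervalIntegral.integral_add (i1.add i2) i3,
    ← intervalIntegral.integral_add ((i1.add i2).add i3) i4]
  congr 1
  ext t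
  ring

/-! ### Core identities -/

/-- the combined kernel -/
noncomputable def kerC (σ N x y : ℝ) : ℝ :=
  (fej N (x - y) - fej N (x + y) + 2 * σ * kerK σ N (x + y)) / 2

lemma kerC_cont {σ : ℝ} (hσ : 0 < σ) (N x : ℝ) : Continuous (kerC σ N x) := by
  have h1 := fej_cont N
  have h2 := kerK_cont hσ N
  unfold kerC
  fun_prop

lemma shift_bound (x y : ℝ) : 1 / (1 + (x - y) ^ 2) ≤ 2 * (1 + x ^ 2) / (1 + y ^ 2) := by
  rw [div_le_div_iff₀ (by positivity) (by positivity)]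
  nlinarith [sq_nonneg (y - 2 * x), sq_nonneg (x * (x - y))]

lemma kerC_bound {σ N : ℝ} (h1 : 1 ≤ σ) (h2 : σ ≤ 2) (hN : 0 < N) (x y : ℝ) :
    |kerC σ N x y| ≤ 130 * (N / 2 + 2 / N) * (1 + x ^ 2) / (1 + y ^ 2) := by
  set D := N / 2 + 2 / N with hD
  have hDpos : 0 < D := by positivity
  have a1 := fej_bound hN (x - y)
  have a2 := fej_bound hN (x + y)
  have a3 := kerK_bound h1 hN (x + y)
  have n1 := fej_nonneg hN (x - y)
  have n2 := fej_nonneg hN (x + y)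
  have n3 := kerK_nonneg (by linarith : 0 < σ) hN (x + y)
  have s1 := shift_bound x y
  have s2 : 1 / (1 + (x + y) ^ 2) ≤ 2 * (1 + x ^ 2) / (1 + y ^ 2) := by
    have := shift_bound x (-y)
    simpa using this
  rw [← hD, div_eq_mul_one_div] at a1 a2 a3
  have b1 : fej N (x - y) ≤ D * (2 * (1 + x ^ 2) / (1 + y ^ 2)) :=
    a1.trans (mul_le_mul_of_nonneg_left s1 hDpos.le)
  have b2 : fej N (x + y) ≤ D * (2 * (1 + x ^ 2) / (1 + y ^ 2)) :=
    a2.trans (mul_le_mul_of_nonneg_left s2 hDpos.le)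
  have b3 : kerK σ N (x + y) ≤ 32 * D * (2 * (1 + x ^ 2) / (1 + y ^ 2)) :=
    a3.trans (mul_le_mul_of_nonneg_left s2 (by positivity))
  have e : 130 * D * (1 + x ^ 2) / (1 + y ^ 2) = 65 * (D * (2 * (1 + x ^ 2) / (1 + y ^ 2))) := by
    ring
  rw [e]
  set Z := D * (2 * (1 + x ^ 2) / (1 + y ^ 2)) with hZ
  have hZ0 : 0 ≤ Z := by positivity
  have b3' : kerK σ N (x + y) ≤ 32 * Z := by rw [hZ]; linarith
  have b4 : σ * kerK σ N (x + y) ≤ 2 * (32 * Z) := mul_le_mul h2 b3' n3 (by norm_num)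
  have b5 : 0 ≤ σ * kerK σ N (x + y) := mul_nonneg (by linarith) n3
  unfold kerC
  rw [abs_le]
  constructor <;> linarith

lemma trig_bound (σ t y : ℝ) : |σ * Real.cos (t * y) + t * Real.sin (t * y)| ≤ |σ| + |t| := by
  refine (abs_add_le _ _).trans ?_
  rw [abs_mul, abs_mul]
  exact add_le_add (mul_le_of_le_one_right (abs_nonneg _) (Real.abs_cos_le_one _))
      (mul_le_of_le_one_right (abs_nonneg _) (Real.abs_sin_le_one _))

lemma fubini_id (S : ℝ → ℝ) (σ N x : ℝ) (hσ : 1 < σ) (hN : 0 < N)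
    (hS : IntegrableOn (fun y => Real.exp (-σ * y) * S y) (Ioi 0)) :
    ∫ t in (0:ℝ)..N, (∫ y in Ioi (0:ℝ), (Real.exp (-σ * y) * S y) *
        (σ * Real.cos (t * y) + t * Real.sin (t * y))) * ((1 - t / N) * symP σ t x)
      = ∫ y in Ioi (0:ℝ), (Real.exp (-σ * y) * S y) * kerC σ N x y := by
  have hσ0 : 0 < σ := by linarith
  simp_rw [← integral_mul_const]
  rw [intervalIntegral.integral_of_le hN.le, integral_integral_swap]
  · congr 1
    ext y
    unfold kerC
    rw [← kernel_identity hσ0, intervalIntegral.integral_of_le hN.le, ← integral_const_mul]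
    congr 1
    ext t
    ring
  · have h1 : IntegrableOn (fun _ : ℝ => (1:ℝ)) (Ioc 0 N) := by simp
    have h2 := Integrable.mul_prod h1 hS
    have hsc : Continuous (fun p : ℝ × ℝ => symP σ p.1 x) := by
      unfold symP
      apply Continuous.div (by fun_prop) (by fun_prop)
      intro p; positivity
    have hcont : Continuous (fun p : ℝ × ℝ => (σ * Real.cos (p.1 * p.2) + p.1 * Real.sin (p.1 * p.2))
        * ((1 - p.1 / N) * symP σ p.1 x)) := by
      apply Continuous.mul (by fun_prop)
      exact Continuous.mul (by fun_prop) hsc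
    have h3 := h2.mul_bdd (c := (σ + N) * 2) hcont.aestronglyMeasurable (by
      rw [Measure.prod_restrict, ae_restrict_iff' (measurableSet_Ioc.prod measurableSet_Ioi)]
      refine Eventually.of_forall fun p hp => ?_
      have ht := hp.1
      have h0 : 0 ≤ 1 - p.1 / N := by rw [sub_nonneg, div_le_one hN]; exact ht.2
      have h1 : 1 - p.1 / N ≤ 1 := by linarith [div_nonneg ht.1.le hN.le]
      rw [norm_mul, norm_mul, Real.norm_of_nonneg h0, Real.norm_eq_abs, Real.norm_eq_abs]
      have t1 := trig_bound σ p.1 p.2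
      rw [abs_of_pos hσ0, abs_of_pos ht.1] at t1
      have t2 := symP_abs_le hσ.le (t := p.1) x
      apply mul_le_mul (t1.trans (by linarith [ht.2])) _ (by positivity) (by positivity)
      nlinarith [abs_nonneg (symP σ p.1 x)])
    refine h3.congr (Eventually.of_forall fun p => ?_)
    simp only [Function.uncurry]
    ring

lemma T_lower (S : ℝ → ℝ) (hS : LogLinSlowlyDecreasing S)
    (hloc : ∀ X, ∃ B, ∀ y, 0 ≤ y → y ≤ X → |Real.exp (-y) * S y| ≤ B) :
    ∃ C, 0 ≤ C ∧ ∀ y, 0 ≤ y → -C ≤ Real.exp (-y) * S y := by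
  obtain ⟨h, hh, x₀, hx₀, hs⟩ := hS 1 one_pos
  obtain ⟨B, hB⟩ := hloc (x₀ + h)
  have hB0 : 0 ≤ B := (abs_nonneg _).trans (hB 0 le_rfl (by linarith))
  refine ⟨B + 1 / h, by positivity, ?_⟩
  have key : ∀ n : ℕ, ∀ y, 0 ≤ y → y ≤ x₀ + h + n * h → -(B + 1 / h) ≤ Real.exp (-y) * S y := by
    intro n
    induction n with
    | zero =>
      intro y hy hyx
      have := (abs_le.1 (hB y hy (by simpa using hyx))).1
      have : 0 < 1 / h := by positivity
      linarith
    | succ n ih =>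
      intro y hy hyx
      by_cases hc : y ≤ x₀ + h
      · have := (abs_le.1 (hB y hy hc)).1
        have : 0 < 1 / h := by positivity
        linarith
      · push Not at hc
        have h1 := ih (y - h) (by linarith) (by push_cast at hyx; linarith)
        have h2 := hs (y - h) y (by linarith) (by linarith) (by linarith)
        have h3 : S y ≥ S (y - h) - Real.exp (y - h) := by
          have := (le_div_iff₀ (Real.exp_pos (y - h))).1 h2
          linarith
        have e1 : Real.exp (-y) = Real.exp (-h) * Real.exp (-(y - h)) := by
          rw [← Real.exp_add]; congr 1; ring
        have e2 : Real.exp (-(y - h)) * Real.exp (y - h) = 1 := by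
          rw [← Real.exp_add]; simp
        have h4 : Real.exp (-y) * S y ≥ Real.exp (-h) * (Real.exp (-(y - h)) * S (y - h) - 1) := by
          calc Real.exp (-y) * S y ≥ Real.exp (-y) * (S (y - h) - Real.exp (y - h)) :=
                mul_le_mul_of_nonneg_left h3 (Real.exp_pos _).le
            _ = Real.exp (-h) * (Real.exp (-(y - h)) * S (y - h)
                - Real.exp (-(y - h)) * Real.exp (y - h)) := by rw [e1]; ring
            _ = _ := by rw [e2]
        have h5 : Real.exp (-h) * (B + 1 / h + 1) ≤ B + 1 / h := by
          have : Real.exp (-h) ≤ 1 / (1 + h) := by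
            rw [Real.exp_neg, ← one_div]
            apply one_div_le_one_div_of_le (by positivity)
            linarith [Real.add_one_le_exp h]
          calc _ ≤ 1 / (1 + h) * (B + 1 / h + 1) := by gcongr
            _ ≤ B + 1 / h := by
              rw [one_div_mul_eq_div, div_le_iff₀ (by positivity)]
              have : 1 / h * h = 1 := by field_simp
              nlinarith [mul_nonneg hB0 hh.le]
        have h6 := mul_le_mul_of_nonneg_left h1 (Real.exp_pos (-h)).le
        nlinarith
  intro y hy
  obtain ⟨n, hn⟩ := exists_nat_ge (y / h)
  refine key n y hy ?_
  rw [div_le_iff₀ hh] at hn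
  linarith

lemma symP_diff {σ : ℝ} (h1 : 1 ≤ σ) (h2 : σ ≤ 2) (t x : ℝ) :
    |symP σ t x - symP 1 t x| ≤ 7 * (σ - 1) := by
  have hd : (1:ℝ) ≤ σ ^ 2 + t ^ 2 := by nlinarith [sq_nonneg t]
  have hd0 : 0 < σ ^ 2 + t ^ 2 := by linarith
  have e : symP σ t x - symP 1 t x
      = ((σ - 1) * (Real.cos (t * x) - (σ + 1) * symP 1 t x)) / (σ ^ 2 + t ^ 2) := by
    unfold symP
    field_simp
    ring
  rw [e, abs_div, abs_of_pos hd0, div_le_iff₀ hd0, abs_mul, abs_of_nonneg (by linarith : 0 ≤ σ - 1)]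
  have b1 : |Real.cos (t * x) - (σ + 1) * symP 1 t x| ≤ 7 := by
    refine (abs_sub _ _).trans ?_
    rw [abs_mul, abs_of_pos (by linarith : 0 < σ + 1)]
    have := Real.abs_cos_le_one (t * x)
    have := symP_abs_le (le_refl (1:ℝ)) (t := t) x
    nlinarith [abs_nonneg (symP 1 t x)]
  nlinarith [mul_nonneg (by linarith : 0 ≤ σ - 1) (abs_nonneg (Real.cos (t * x) - (σ + 1) * symP 1 t x))]

/-! ### Weighted integrability -/

lemma one_add_sq_inv_int : Integrable (fun y : ℝ => 1 / (1 + y ^ 2)) := by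
  simpa [one_div] using integrable_inv_one_add_sq

lemma loc_integrable {g : ℝ → ℝ} (hg : Measurable g) (m : ℝ) (B : ℝ)
    (hB : ∀ y, 0 ≤ y → y ≤ m → |g y| ≤ B) : IntegrableOn g (Ioc 0 m) := by
  refine Measure.integrableOn_of_bounded (M := B) (by simp) hg.aestronglyMeasurable ?_
  rw [ae_restrict_iff' measurableSet_Ioc]
  exact Eventually.of_forall fun y hy => hB y hy.1.le hy.2

lemma T_weighted (S : ℝ → ℝ) (hSm : Measurable S)
    (hloc : ∀ X, ∃ B, ∀ y, 0 ≤ y → y ≤ X → |Real.exp (-y) * S y| ≤ B)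
    (C : ℝ) (hC : 0 ≤ C) (hlow : ∀ y, 0 ≤ y → -C ≤ Real.exp (-y) * S y)
    (s : ℕ → ℝ) (hs1 : ∀ n, 1 < s n) (hs2 : ∀ n, s n < 2) (hs : Tendsto s atTop (nhds 1))
    (hInt : ∀ σ, 1 < σ → IntegrableOn (fun y => Real.exp (-σ * y) * S y) (Ioi 0))
    (B : ℝ) (hB : ∀ n, ∫ y in Ioi (0:ℝ), (Real.exp (-(s n) * y) * S y) * kerC (s n) 1 0 y ≤ B) :
    IntegrableOn (fun y => Real.exp (-y) * S y / (1 + y ^ 2)) (Ioi 0) := by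
  obtain ⟨c, hc, hker⟩ := kerK_lower
  set g : ℝ → ℝ := fun y => (Real.exp (-y) * S y + C) / (1 + y ^ 2) with hg
  have hgm : Measurable g := by
    rw [hg]; fun_prop
  have hg0 : ∀ y, 0 ≤ y → 0 ≤ g y := fun y hy =>
    div_nonneg (by linarith [hlow y hy]) (by positivity)
  have hgi : ∀ m, IntegrableOn g (Ioc 0 m) := by
    intro m
    obtain ⟨B, hB⟩ := hloc m
    refine loc_integrable hgm m (B + C) fun y h0 h1 => ?_
    rw [hg]
    simp only
    rw [abs_div, abs_of_pos (by positivity : 0 < 1 + y ^ 2)]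
    refine (div_le_self (abs_nonneg _) (by nlinarith [sq_nonneg y])).trans ?_
    refine (abs_add_le _ _).trans ?_
    rw [abs_of_nonneg hC]
    linarith [hB y h0 h1]
  set J : ℝ := ∫ y in Ioi (0:ℝ), 1 / (1 + y ^ 2) with hJ
  set B' : ℝ := B + C * (160 * J) with hB'
  have hD : (1:ℝ) / 2 + 2 / 1 = 5 / 2 := by norm_num
  -- the nonnegative integrand
  have main : ∀ m : ℕ, ∫ y in (0:ℝ)..m, ‖g y‖ ≤ Real.exp 1 / c * B' := by
    intro m
    have hm0 : (0:ℝ) ≤ m := Nat.cast_nonneg m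
    obtain ⟨n, hn⟩ : ∃ n, (s n - 1) * m ≤ 1 := by
      have h1 : Tendsto (fun n => (s n - 1) * m) atTop (nhds ((1 - 1) * m)) :=
        (hs.sub_const 1).mul_const _
      have h2 : ∀ᶠ n in atTop, (s n - 1) * m < 1 := h1.eventually_lt_const (by norm_num)
      obtain ⟨n, hn⟩ := h2.exists
      exact ⟨n, hn.le⟩
    set σ := s n with hσ
    have hσ1 : 1 < σ := hs1 n
    have hσ2 : σ < 2 := hs2 n
    have hK : ∀ y, kerC σ 1 0 y = σ * kerK σ 1 y := by
      intro y
      unfold kerC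
      rw [zero_sub, fej_neg, zero_add]; ring
    have hKc := kerK_cont (by linarith : 0 < σ) 1
    have hK0 : ∀ y, 0 ≤ kerK σ 1 y := kerK_nonneg (by linarith) one_pos
    have hKb : ∀ y, kerK σ 1 y ≤ 80 * (1 / (1 + y ^ 2)) := by
      intro y
      have := kerK_bound hσ1.le one_pos y
      rw [hD] at this
      refine this.trans (le_of_eq ?_)
      ring
    have hKb2 : ∀ y, ‖σ * kerK σ 1 y‖ ≤ 160 * (1 / (1 + y ^ 2)) := by
      intro y
      rw [Real.norm_of_nonneg (mul_nonneg (by linarith) (hK0 y))]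
      calc σ * kerK σ 1 y ≤ 2 * (80 * (1 / (1 + y ^ 2))) :=
            mul_le_mul hσ2.le (hKb y) (hK0 y) (by norm_num)
        _ = _ := by ring
    have i1 : IntegrableOn (fun y => (Real.exp (-σ * y) * S y) * (σ * kerK σ 1 y)) (Ioi 0) := by
      refine (hInt σ hσ1).mul_bdd (c := 160) (by fun_prop) (Eventually.of_forall fun y => ?_)
      refine (hKb2 y).trans ?_
      have : 1 / (1 + y ^ 2) ≤ 1 := by
        rw [div_le_one (by positivity)]; nlinarith [sq_nonneg y]
      linarith
    have iJ : IntegrableOn (fun y : ℝ => 160 * (1 / (1 + y ^ 2))) (Ioi 0) :=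
      (one_add_sq_inv_int.const_mul 160).integrableOn
    have hb2 : ∀ᵐ y ∂(volume.restrict (Ioi (0:ℝ))),
        ‖Real.exp (-(σ - 1) * y) * (σ * kerK σ 1 y)‖ ≤ 160 * (1 / (1 + y ^ 2)) := by
      rw [ae_restrict_iff' measurableSet_Ioi]
      refine Eventually.of_forall fun y (hy : 0 < y) => ?_
      rw [norm_mul, Real.norm_of_nonneg (Real.exp_pos _).le]
      have : Real.exp (-(σ - 1) * y) ≤ 1 := by
        rw [Real.exp_le_one_iff]; nlinarith
      exact (mul_le_of_le_one_left (norm_nonneg _) this).trans (hKb2 y)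
    have i2 : IntegrableOn (fun y => Real.exp (-(σ - 1) * y) * (σ * kerK σ 1 y)) (Ioi 0) :=
      Integrable.mono' iJ (by fun_prop) hb2
    have v2 : ∫ y in Ioi (0:ℝ), Real.exp (-(σ - 1) * y) * (σ * kerK σ 1 y) ≤ 160 * J := by
      rw [hJ, ← integral_const_mul]
      refine integral_mono_ae i2 iJ ?_
      filter_upwards [hb2] with y hy
      exact (le_abs_self _).trans hy
    have hB1 : ∫ y in Ioi (0:ℝ), (Real.exp (-σ * y) * S y) * (σ * kerK σ 1 y) ≤ B := by
      have := hB n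
      simp only [← hσ, hK] at this
      exact this
    set G : ℝ → ℝ := fun y => (Real.exp (-σ * y) * S y) * (σ * kerK σ 1 y)
      + C * (Real.exp (-(σ - 1) * y) * (σ * kerK σ 1 y)) with hG
    have iG : IntegrableOn G (Ioi 0) := i1.add (i2.const_mul C)
    have vG : ∫ y in Ioi (0:ℝ), G y ≤ B' := by
      rw [hG, integral_add i1 (i2.const_mul C), integral_const_mul]
      have := mul_le_mul_of_nonneg_left v2 hC
      linarith
    have eG : ∀ y, G y = Real.exp (-(σ - 1) * y) * (Real.exp (-y) * S y + C) * (σ * kerK σ 1 y) := by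
      intro y
      rw [hG]
      simp only
      have : Real.exp (-σ * y) = Real.exp (-(σ - 1) * y) * Real.exp (-y) := by
        rw [← Real.exp_add]; congr 1; ring
      rw [this]; ring
    have G0 : ∀ y, 0 ≤ y → 0 ≤ G y := by
      intro y hy
      rw [eG]
      have := hlow y hy
      exact mul_nonneg (mul_nonneg (Real.exp_pos _).le (by linarith)) (mul_nonneg (by linarith) (hK0 y))
    have comp : ∀ y ∈ Ioc (0:ℝ) m, g y ≤ Real.exp 1 / c * G y := by
      intro y hy
      rw [eG, hg]
      simp only
      have t0 : 0 ≤ Real.exp (-y) * S y + C := by linarith [hlow y hy.1.le]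
      have k1 : c / (1 + y ^ 2) ≤ σ * kerK σ 1 y :=
        (hker σ hσ1.le hσ2.le y hy.1.le).trans (le_mul_of_one_le_left (hK0 y) hσ1.le)
      have k2 : Real.exp (-1) ≤ Real.exp (-(σ - 1) * y) := by
        apply Real.exp_le_exp.2
        nlinarith [mul_le_mul_of_nonneg_left hy.2 (by linarith : 0 ≤ σ - 1)]
      have k3 : Real.exp (-1) * (Real.exp (-y) * S y + C) * (c / (1 + y ^ 2)) ≤
          Real.exp (-(σ - 1) * y) * (Real.exp (-y) * S y + C) * (σ * kerK σ 1 y) := by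
        gcongr
      calc (Real.exp (-y) * S y + C) / (1 + y ^ 2)
          = Real.exp 1 / c * (Real.exp (-1) * (Real.exp (-y) * S y + C) * (c / (1 + y ^ 2))) := by
            have e1 : Real.exp 1 * Real.exp (-1) = 1 := by
              rw [← Real.exp_add]; simp
            generalize Real.exp (-y) * S y + C = Z
            have hy2 : (1 + y ^ 2) ≠ 0 := by positivity
            have hcne : c ≠ 0 := hc.ne'
            calc Z / (1 + y ^ 2) = (Real.exp 1 * Real.exp (-1)) * Z / (1 + y ^ 2) := by
                  rw [e1, one_mul]
              _ = _ := by field_simp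
        _ ≤ _ := mul_le_mul_of_nonneg_left k3 (by positivity)
    rw [intervalIntegral.integral_of_le hm0]
    calc ∫ y in Ioc (0:ℝ) m, ‖g y‖ ≤ ∫ y in Ioc (0:ℝ) m, Real.exp 1 / c * G y := by
          refine setIntegral_mono_on (hgi m).norm ((iG.mono_set Ioc_subset_Ioi_self).const_mul _)
            measurableSet_Ioc fun y hy => ?_
          rw [Real.norm_of_nonneg (hg0 y hy.1.le)]
          exact comp y hy
      _ = Real.exp 1 / c * ∫ y in Ioc (0:ℝ) m, G y := integral_const_mul _ _
      _ ≤ Real.exp 1 / c * ∫ y in Ioi (0:ℝ), G y := by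
          refine mul_le_mul_of_nonneg_left ?_ (by positivity)
          refine setIntegral_mono_set iG ?_ (Eventually.of_forall Ioc_subset_Ioi_self)
          rw [EventuallyLE, ae_restrict_iff' measurableSet_Ioi]
          exact Eventually.of_forall fun y (hy : 0 < y) => G0 y hy.le
      _ ≤ _ := mul_le_mul_of_nonneg_left vG (by positivity)
  have hgI : IntegrableOn g (Ioi 0) :=
    integrableOn_Ioi_of_intervalIntegral_norm_bounded (b := fun m : ℕ => (m:ℝ)) (l := atTop)
      _ 0 (fun m => hgi m) tendsto_natCast_atTop_atTop (Eventually.of_forall main)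
  have := hgI.sub ((one_add_sq_inv_int.const_mul C).integrableOn (s := Ioi 0))
  refine this.congr (Eventually.of_forall fun y => ?_)
  simp only [hg, Pi.sub_apply]
  ring

/-! ### Passing to the limit -/

lemma core_identity (S : ℝ → ℝ) (hSm : Measurable S)
    (hW : IntegrableOn (fun y => Real.exp (-y) * S y / (1 + y ^ 2)) (Ioi 0))
    (s : ℕ → ℝ) (hs1 : ∀ n, 1 < s n) (hs2 : ∀ n, s n < 2) (hs : Tendsto s atTop (nhds 1))
    (N x : ℝ) (hN : 0 < N) (L : ℝ)
    (hlim : Tendsto (fun n => ∫ y in Ioi (0:ℝ), (Real.exp (-(s n) * y) * S y) * kerC (s n) N x y)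
      atTop (nhds L)) :
    ∫ y in Ioi (0:ℝ), (Real.exp (-y) * S y) * kerC 1 N x y = L := by
  refine tendsto_nhds_unique ?_ hlim
  set K := 130 * (N / 2 + 2 / N) * (1 + x ^ 2) with hK
  have hK0 : 0 ≤ K := by positivity
  refine tendsto_integral_of_dominated_convergence
    (fun y => K * ‖Real.exp (-y) * S y / (1 + y ^ 2)‖) ?_ (hW.norm.const_mul K) ?_ ?_
  · intro n
    have := kerC_cont (by linarith [hs1 n] : 0 < s n) N x
    exact (((by fun_prop : Measurable (fun y => Real.exp (-(s n) * y))).mul hSm).mul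
      this.measurable).aestronglyMeasurable
  · intro n
    rw [ae_restrict_iff' measurableSet_Ioi]
    refine Eventually.of_forall fun y (hy : 0 < y) => ?_
    have h1 := kerC_bound (hs1 n).le (hs2 n).le hN x y
    rw [← hK] at h1
    have h2 : Real.exp (-(s n) * y) ≤ Real.exp (-y) := by
      apply Real.exp_le_exp.2; nlinarith [hs1 n]
    rw [norm_mul, norm_mul, norm_div, norm_mul, Real.norm_of_nonneg (Real.exp_pos _).le,
      Real.norm_of_nonneg (Real.exp_pos _).le,
      Real.norm_of_nonneg (by positivity : (0:ℝ) ≤ 1 + y ^ 2), Real.norm_eq_abs (kerC _ _ _ _)]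
    calc Real.exp (-(s n) * y) * ‖S y‖ * |kerC (s n) N x y|
        ≤ Real.exp (-y) * ‖S y‖ * (K / (1 + y ^ 2)) := by gcongr
      _ = _ := by ring
  · refine Eventually.of_forall fun y => ?_
    have h1 : Tendsto (fun n => Real.exp (-(s n) * y)) atTop (nhds (Real.exp (-y))) := by
      have : Tendsto (fun n => -(s n) * y) atTop (nhds (-1 * y)) := (hs.neg).mul_const y
      have h := (Real.continuous_exp.tendsto _).comp this
      simpa [Function.comp_def] using h
    have h2 := kerK_tendsto hN (x + y) hs1 hs
    refine (h1.mul_const (S y)).mul ?_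
    unfold kerC
    exact ((((hs.const_mul 2).mul h2).const_add _).div_const 2)

lemma riemann_lebesgue (g : ℝ → ℝ) (hg : Integrable g) :
    Tendsto (fun x : ℝ => ∫ t, g t * Real.cos (t * x)) atTop (nhds 0) ∧
    Tendsto (fun x : ℝ => ∫ t, g t * Real.sin (t * x)) atTop (nhds 0) := by
  have h := Real.tendsto_integral_exp_smul_cocompact (fun t => (g t : ℂ))
  have hx : Tendsto (fun x : ℝ => x / (2 * Real.pi)) atTop (cocompact ℝ) :=
    (tendsto_id.atTop_div_const (by positivity)).mono_right atTop_le_cocompact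
  have h2 := h.comp hx
  have e : ∀ x t : ℝ, (Real.fourierChar (-(t * (x / (2 * Real.pi)))) • (g t : ℂ))
      = ((g t * Real.cos (t * x) : ℝ) : ℂ) - ((g t * Real.sin (t * x) : ℝ) : ℂ) * Complex.I := by
    intro x t
    rw [Circle.smul_def, Real.fourierChar_apply]
    have : ((2 * Real.pi * -(t * (x / (2 * Real.pi))) : ℝ) : ℂ) * Complex.I
        = ((-(t * x) : ℝ) : ℂ) * Complex.I := by
      congr 2
      field_simp
    rw [this, Complex.exp_mul_I, ← Complex.ofReal_cos, ← Complex.ofReal_sin, Real.cos_neg,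
      Real.sin_neg]
    push_cast
    simp only [smul_eq_mul]
    ring
  have ic : ∀ x : ℝ, Integrable (fun t => g t * Real.cos (t * x)) := fun x =>
    hg.mul_bdd (c := 1) (by fun_prop) (Eventually.of_forall fun t => Real.abs_cos_le_one _)
  have is : ∀ x : ℝ, Integrable (fun t => g t * Real.sin (t * x)) := fun x =>
    hg.mul_bdd (c := 1) (by fun_prop) (Eventually.of_forall fun t => Real.abs_sin_le_one _)
  have e2 : ∀ x : ℝ, ∫ t, (Real.fourierChar (-(t * (x / (2 * Real.pi)))) • (g t : ℂ))
      = ((∫ t, g t * Real.cos (t * x) : ℝ) : ℂ) - ((∫ t, g t * Real.sin (t * x) : ℝ) : ℂ) * Complex.I := by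
    intro x
    simp_rw [e]
    rw [integral_sub (ic x).ofReal ((is x).ofReal.mul_const _), integral_mul_const]
    rw [integral_complex_ofReal, integral_complex_ofReal]
  have h3 : Tendsto (fun x : ℝ => ((∫ t, g t * Real.cos (t * x) : ℝ) : ℂ)
      - ((∫ t, g t * Real.sin (t * x) : ℝ) : ℂ) * Complex.I) atTop (nhds 0) := by
    refine h2.congr fun x => ?_
    exact e2 x
  constructor
  · have := (Complex.continuous_re.tendsto _).comp h3
    simpa [Function.comp_def] using this
  · have := ((Complex.continuous_im.tendsto _).comp h3).neg
    simpa [Function.comp_def] using this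

lemma rl_term (f : ℝ → ℝ) (N : ℝ) (hN : 0 < N) (hf : IntegrableOn f (Ioc 0 N)) :
    Tendsto (fun x : ℝ => ∫ t in (0:ℝ)..N, f t * ((1 - t / N) * symP 1 t x)) atTop (nhds 0) := by
  have c1 : Continuous (fun t : ℝ => (1 - t / N) / (1 + t ^ 2)) := by
    apply Continuous.div (by fun_prop) (by fun_prop)
    intro t; positivity
  have c2 : Continuous (fun t : ℝ => t * ((1 - t / N) / (1 + t ^ 2))) := by fun_prop
  have hf' := (integrableOn_Icc_iff_integrableOn_Ioc (f := f) (a := 0) (b := N) (μ := volume)).2 hf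
  have g1 : IntegrableOn (fun t => f t * ((1 - t / N) / (1 + t ^ 2))) (Ioc 0 N) :=
    (hf'.mul_continuousOn c1.continuousOn isCompact_Icc).mono_set Ioc_subset_Icc_self
  have g2 : IntegrableOn (fun t => f t * (t * ((1 - t / N) / (1 + t ^ 2)))) (Ioc 0 N) :=
    (hf'.mul_continuousOn c2.continuousOn isCompact_Icc).mono_set Ioc_subset_Icc_self
  have r1 := (riemann_lebesgue ((Ioc 0 N).indicator (fun t => f t * ((1 - t / N) / (1 + t ^ 2)))) (g1.integrable_indicator measurableSet_Ioc)).1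
  have r2 := (riemann_lebesgue ((Ioc 0 N).indicator (fun t => f t * (t * ((1 - t / N) / (1 + t ^ 2))))) (g2.integrable_indicator measurableSet_Ioc)).2
  have r := r1.add r2
  rw [add_zero] at r
  refine r.congr fun x => ?_
  have ec : ∀ (g : ℝ → ℝ) (k : ℝ → ℝ), ∫ t, (Ioc 0 N).indicator g t * k t = ∫ t in Ioc 0 N, g t * k t := by
    intro g k
    rw [← integral_indicator measurableSet_Ioc]
    congr 1
    ext t
    by_cases ht : t ∈ Ioc 0 N <;> simp [ht]
  rw [ec, ec, intervalIntegral.integral_of_le hN.le, ← integral_add]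
  · congr 1
    ext t
    unfold symP
    ring
  · exact Integrable.mul_bdd (c := 1) g1 (by fun_prop) (Eventually.of_forall fun t => Real.abs_cos_le_one _)
  · exact Integrable.mul_bdd (c := 1) g2 (by fun_prop) (Eventually.of_forall fun t => Real.abs_sin_le_one _)

lemma conv_limit (S : ℝ → ℝ) (hSm : Measurable S)
    (hW : IntegrableOn (fun y => Real.exp (-y) * S y / (1 + y ^ 2)) (Ioi 0))
    (N : ℝ) (hN : 0 < N) (A : ℝ) (r : ℝ → ℝ) (hr : Tendsto r atTop (nhds 0))
    (hid : ∀ x, ∫ y in Ioi (0:ℝ), (Real.exp (-y) * S y) * kerC 1 N x y = r x + A) :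
    Tendsto (fun x => ∫ y in Ioi (0:ℝ), (Real.exp (-y) * S y) * fej N (x - y)) atTop
      (nhds (2 * A)) := by
  set D := N / 2 + 2 / N with hD
  have hD0 : 0 < D := by positivity
  set R : ℝ → ℝ → ℝ := fun x y => -fej N (x + y) + 2 * kerK 1 N (x + y) with hR
  have fc := fej_cont N
  have kc := kerK_cont one_pos N
  have hRb : ∀ x y, |R x y| ≤ 65 * D * (1 / (1 + (x + y) ^ 2)) := by
    intro x y
    have a2 := fej_bound hN (x + y)
    have a3 := kerK_bound le_rfl hN (x + y)
    have n2 := fej_nonneg hN (x + y)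
    have n3 := kerK_nonneg one_pos hN (x + y)
    rw [← hD, div_eq_mul_one_div] at a2 a3
    rw [hR, abs_le]
    constructor <;> simp only <;> linarith
  have hTm : Measurable (fun y => Real.exp (-y) * S y) := by fun_prop
  have dom : ∀ (k : ℝ → ℝ) (K : ℝ), Continuous k → (∀ y, 0 < y → |k y| ≤ K * (1 / (1 + y ^ 2))) →
      IntegrableOn (fun y => (Real.exp (-y) * S y) * k y) (Ioi 0) := by
    intro k K hk hb
    refine Integrable.mono' (hW.norm.const_mul K) (hTm.mul hk.measurable).aestronglyMeasurable ?_
    rw [ae_restrict_iff' measurableSet_Ioi]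
    refine Eventually.of_forall fun y (hy : 0 < y) => ?_
    rw [norm_mul, norm_div, Real.norm_of_nonneg (by positivity : (0:ℝ) ≤ 1 + y ^ 2)]
    calc _ ≤ ‖Real.exp (-y) * S y‖ * (K * (1 / (1 + y ^ 2))) :=
          mul_le_mul_of_nonneg_left (hb y hy) (norm_nonneg _)
      _ = _ := by ring
  have mono : ∀ x y : ℝ, 0 ≤ x → 0 < y → 1 / (1 + (x + y) ^ 2) ≤ 1 / (1 + y ^ 2) := by
    intro x y hx hy
    apply one_div_le_one_div_of_le (by positivity)
    nlinarith [mul_nonneg hx hy.le, sq_nonneg x]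
  have hRint : ∀ x, 0 ≤ x → IntegrableOn (fun y => (Real.exp (-y) * S y) * R x y) (Ioi 0) := by
    intro x hx
    refine dom (R x) (65 * D) (by rw [hR]; fun_prop) fun y hy => ?_
    exact (hRb x y).trans (mul_le_mul_of_nonneg_left (mono x y hx hy) (by positivity))
  have hFint : ∀ x, IntegrableOn (fun y => (Real.exp (-y) * S y) * fej N (x - y)) (Ioi 0) := by
    intro x
    refine dom (fun y => fej N (x - y)) (D * (2 * (1 + x ^ 2))) (by fun_prop) fun y hy => ?_
    rw [abs_of_nonneg (fej_nonneg hN _)]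
    have a1 := fej_bound hN (x - y)
    rw [← hD, div_eq_mul_one_div] at a1
    refine (a1.trans (mul_le_mul_of_nonneg_left (shift_bound x y) hD0.le)).trans (le_of_eq ?_)
    ring
  have hR0 : Tendsto (fun x => ∫ y in Ioi (0:ℝ), (Real.exp (-y) * S y) * R x y) atTop (nhds 0) := by
    suffices hsuf : Tendsto (fun x => ∫ y in Ioi (0:ℝ), (Real.exp (-y) * S y) * R x y) atTop
        (nhds (∫ y in Ioi (0:ℝ), (0:ℝ))) by simpa using hsuf
    refine tendsto_integral_filter_of_dominated_convergence (l := (atTop : Filter ℝ))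
      (fun y => (65 * D) * ‖Real.exp (-y) * S y / (1 + y ^ 2)‖) ?_ ?_ (hW.norm.const_mul _) ?_
    · filter_upwards [eventually_ge_atTop 0] with x hx
      exact (hRint x hx).aestronglyMeasurable
    · filter_upwards [eventually_ge_atTop 0] with x hx
      rw [ae_restrict_iff' measurableSet_Ioi]
      refine Eventually.of_forall fun y (hy : 0 < y) => ?_
      rw [norm_mul, norm_div, Real.norm_of_nonneg (by positivity : (0:ℝ) ≤ 1 + y ^ 2)]
      have hb := (hRb x y).trans (mul_le_mul_of_nonneg_left (mono x y hx hy) (by positivity))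
      calc _ ≤ ‖Real.exp (-y) * S y‖ * (65 * D * (1 / (1 + y ^ 2))) :=
            mul_le_mul_of_nonneg_left hb (norm_nonneg _)
        _ = _ := by ring
    · refine Eventually.of_forall fun y => ?_
      rw [← mul_zero (Real.exp (-y) * S y)]
      refine Tendsto.const_mul _ ?_
      refine squeeze_zero_norm (hRb · y) ?_
      rw [← mul_zero (65 * D)]
      refine Tendsto.const_mul _ ?_
      simp only [one_div]
      refine tendsto_inv_atTop_zero.comp ?_
      refine tendsto_atTop_add_const_left _ _ ?_
      exact (tendsto_pow_atTop (by norm_num)).comp (tendsto_atTop_add_const_right _ y tendsto_id)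
  have hfin := ((hr.add_const A).const_mul 2).sub hR0
  rw [zero_add, sub_zero] at hfin
  refine hfin.congr' ?_
  filter_upwards [eventually_ge_atTop 0] with x hx
  rw [← hid x, ← integral_const_mul, ← integral_sub]
  · congr 1
    ext y
    rw [hR]
    unfold kerC
    ring
  · have := ((hFint x).add (hRint x hx))
    refine this.congr (Eventually.of_forall fun y => ?_)
    simp only [Pi.add_apply, hR]
    unfold kerC
    ring
  · exact hRint x hx

/-! ### Tauberian argument -/

lemma fej_shift_int {N : ℝ} (hN : 0 < N) (x : ℝ) : Integrable (fun y => fej N (x - y)) :=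
  (fej_integrable hN).comp_sub_left x

lemma fej_shift_integral {N : ℝ} (hN : 0 < N) (x : ℝ) : ∫ y, fej N (x - y) = ∫ y, fej 1 y := by
  rw [integral_sub_left_eq_self (fun y => fej N y) volume x, fej_integral hN]

lemma taub_bounded (T : ℝ → ℝ) (C : ℝ) (hC : 0 ≤ C) (hlow : ∀ y, -C ≤ T y)
    (hslow : ∀ ε, 0 < ε → ∃ h, 0 < h ∧ ∃ x₀, 0 < x₀ ∧ ∀ x y, x₀ ≤ x → x ≤ y → y ≤ x + h →
      Real.exp (-(y - x)) * (T x - ε) ≤ T y)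
    (hloc : ∀ X, ∃ B, ∀ y, y ≤ X → |T y| ≤ B)
    (hInt : ∀ x, Integrable (fun y => T y * fej 1 (x - y)))
    (L : ℝ) (hlim : Tendsto (fun x => ∫ y, T y * fej 1 (x - y)) atTop (nhds L)) :
    ∃ B, 0 ≤ B ∧ ∀ y, |T y| ≤ B := by
  obtain ⟨h, hh, x₀, hx₀, hs⟩ := hslow 1 one_pos
  set I0 := ∫ y, fej 1 y with hI0
  have hev : ∀ᶠ x in atTop, ∫ y, T y * fej 1 (x - y) < L + 1 :=
    hlim.eventually_lt_const (by linarith)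
  obtain ⟨x₁, hx₁⟩ := eventually_atTop.1 hev
  set p := ∫ y in (0:ℝ)..h, fej 1 y with hp
  have hp0 : 0 < p := by
    refine intervalIntegral.integral_pos hh (fej_cont 1).continuousOn
      (fun y _ => fej_nonneg one_pos y) ⟨0, ⟨le_rfl, hh.le⟩, ?_⟩
    rw [fej_zero] <;> norm_num
  set M := L + 1 + C * I0 with hM
  obtain ⟨B, hB⟩ := hloc (max x₀ x₁)
  have hB0 : 0 ≤ B := (abs_nonneg _).trans (hB 0 (le_max_of_le_left hx₀.le))
  have up : ∀ x, max x₀ x₁ ≤ x → T x ≤ 1 + |M| * (Real.exp h / p) := by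
    intro x hx
    by_cases hT : T x ≤ 1
    · have : 0 ≤ |M| * (Real.exp h / p) := by positivity
      linarith
    push Not at hT
    have i1 : Integrable (fun y => T y * fej 1 (x - y) + C * fej 1 (x - y)) :=
      (hInt x).add ((fej_shift_int one_pos x).const_mul C)
    have v1 : ∫ y, (T y * fej 1 (x - y) + C * fej 1 (x - y)) ≤ M := by
      rw [integral_add (hInt x) ((fej_shift_int one_pos x).const_mul C), integral_const_mul,
        fej_shift_integral one_pos]
      have := hx₁ x ((le_max_right _ _).trans hx)
      linarith
    have v2 : ∫ y in Ioc x (x + h), (T y * fej 1 (x - y) + C * fej 1 (x - y)) ≤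
        ∫ y, (T y * fej 1 (x - y) + C * fej 1 (x - y)) := by
      refine setIntegral_le_integral i1 (Eventually.of_forall fun y => ?_)
      have := fej_nonneg one_pos (x - y)
      simp only [Pi.zero_apply]
      rw [← add_mul]
      exact mul_nonneg (by linarith [hlow y]) this
    have v3 : ∫ y in Ioc x (x + h), (Real.exp (-h) * (T x - 1)) * fej 1 (x - y) ≤
        ∫ y in Ioc x (x + h), (T y * fej 1 (x - y) + C * fej 1 (x - y)) := by
      refine setIntegral_mono_on ((fej_shift_int one_pos x).const_mul _).integrableOn
        i1.integrableOn measurableSet_Ioc fun y hy => ?_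
      have f0 := fej_nonneg one_pos (x - y)
      rw [← add_mul]
      refine mul_le_mul_of_nonneg_right ?_ f0
      have h1 := hs x y ((le_max_left _ _).trans hx) hy.1.le hy.2
      have h2 : Real.exp (-h) ≤ Real.exp (-(y - x)) := Real.exp_le_exp.2 (by linarith [hy.2])
      have h3 := mul_le_mul_of_nonneg_right h2 (by linarith : 0 ≤ T x - 1)
      linarith
    have v4 : ∫ y in Ioc x (x + h), (Real.exp (-h) * (T x - 1)) * fej 1 (x - y)
        = Real.exp (-h) * (T x - 1) * p := by
      rw [integral_const_mul, ← intervalIntegral.integral_of_le (by linarith)]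
      congr 1
      have : ∀ y, fej 1 (x - y) = fej 1 (y - x) := by
        intro y; rw [← fej_neg 1 (y - x)]; congr 1; ring
      simp_rw [this]
      rw [intervalIntegral.integral_comp_sub_right (fun y => fej 1 y) x]
      simp [hp]
    have v5 : Real.exp (-h) * (T x - 1) * p ≤ |M| := by
      have := le_abs_self M
      linarith
    have e1 : Real.exp (-h) * Real.exp h = 1 := by rw [← Real.exp_add]; simp
    have : T x - 1 = (Real.exp (-h) * (T x - 1) * p) * (Real.exp h / p) := by
      calc T x - 1 = (Real.exp (-h) * Real.exp h) * (T x - 1) := by rw [e1, one_mul]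
        _ = _ := by field_simp
    have h6 := mul_le_mul_of_nonneg_right v5 (by positivity : 0 ≤ Real.exp h / p)
    linarith
  refine ⟨B + C + (1 + |M| * (Real.exp h / p)), by positivity, fun y => ?_⟩
  have q0 : 0 ≤ |M| * (Real.exp h / p) := by positivity
  rcases le_total y (max x₀ x₁) with hy | hy
  · have := hB y hy
    linarith
  · rw [abs_le]
    have := up y hy
    have := hlow y
    constructor <;> linarith

lemma fej_tail {N h : ℝ} (hN : 0 < N) (hh : 0 < h) {v : ℝ} (hv : h < |v|) :
    fej N v ≤ 2 / N * (1 + 1 / h ^ 2) * (1 / (1 + v ^ 2)) := by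
  have h1 := fej_sq_le hN v
  have h2 : h ^ 2 < v ^ 2 := by
    rw [← sq_abs v]; exact pow_lt_pow_left₀ hv hh.le (by norm_num)
  have h3 : 1 + v ^ 2 ≤ (1 + 1 / h ^ 2) * v ^ 2 := by
    have : 1 ≤ 1 / h ^ 2 * v ^ 2 := by
      rw [one_div_mul_eq_div, one_le_div (by positivity)]; exact h2.le
    linarith
  rw [mul_one_div, le_div_iff₀ (by positivity)]
  calc fej N v * (1 + v ^ 2) ≤ fej N v * ((1 + 1 / h ^ 2) * v ^ 2) :=
        mul_le_mul_of_nonneg_left h3 (fej_nonneg hN v)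
    _ = (v ^ 2 * fej N v) * (1 + 1 / h ^ 2) := by ring
    _ ≤ _ := mul_le_mul_of_nonneg_right h1 (by positivity)

/-- one sided comparison of a window with the Fejer mean -/
lemma window_ineq (T : ℝ → ℝ) (B : ℝ) (hB : ∀ y, |T y| ≤ B) (k h N z : ℝ) (hh : 0 < h)
    (hN : 0 < N) (hk : |k| ≤ B + 2) (hB0 : 0 ≤ B)
    (hInt : Integrable (fun y => T y * fej N (z - y)))
    (hw : ∀ y, |z - y| ≤ h → k ≤ T y) :
    k * (∫ y, fej 1 y) ≤ (∫ y, T y * fej N (z - y)) +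
      (2 * B + 2) * (2 / N * (1 + 1 / h ^ 2)) * ∫ y : ℝ, 1 / (1 + y ^ 2) := by
  have it : Integrable (fun y => (2 * B + 2) * (2 / N * (1 + 1 / h ^ 2)) * (1 / (1 + (z - y) ^ 2))) :=
    (one_add_sq_inv_int.comp_sub_left z).const_mul _
  have e1 : ∫ y, (2 * B + 2) * (2 / N * (1 + 1 / h ^ 2)) * (1 / (1 + (z - y) ^ 2))
      = (2 * B + 2) * (2 / N * (1 + 1 / h ^ 2)) * ∫ y : ℝ, 1 / (1 + y ^ 2) := by
    rw [integral_const_mul, integral_sub_left_eq_self (fun y => 1 / (1 + y ^ 2)) volume z]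
  rw [← e1, ← integral_add hInt it, ← fej_shift_integral hN z, ← integral_const_mul]
  refine integral_mono ((fej_shift_int hN z).const_mul k) (hInt.add it) fun y => ?_
  simp only
  have f0 := fej_nonneg hN (z - y)
  by_cases hy : |z - y| ≤ h
  · have h1 := mul_le_mul_of_nonneg_right (hw y hy) f0
    have : 0 ≤ (2 * B + 2) * (2 / N * (1 + 1 / h ^ 2)) * (1 / (1 + (z - y) ^ 2)) := by positivity
    linarith
  · push Not at hy
    have h1 := fej_tail hN hh hy
    have h2 := (abs_le.1 (hB y)).1
    have h3 := (abs_le.1 hk).2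
    have h4 : (k - T y) * fej N (z - y) ≤ (2 * B + 2) * fej N (z - y) :=
      mul_le_mul_of_nonneg_right (by linarith) f0
    have h5 := mul_le_mul_of_nonneg_left h1 (by positivity : 0 ≤ 2 * B + 2)
    nlinarith

lemma taub_main (T : ℝ → ℝ) (C : ℝ) (hC : 0 ≤ C) (hlow : ∀ y, -C ≤ T y)
    (hslow : ∀ ε, 0 < ε → ∃ h, 0 < h ∧ ∃ x₀, 0 < x₀ ∧ ∀ x y, x₀ ≤ x → x ≤ y → y ≤ x + h →
      Real.exp (-(y - x)) * (T x - ε) ≤ T y)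
    (hloc : ∀ X, ∃ B, ∀ y, y ≤ X → |T y| ≤ B)
    (hInt : ∀ N, 0 < N → ∀ x, Integrable (fun y => T y * fej N (x - y)))
    (L : ℝ) (hlim : ∀ N, 0 < N → Tendsto (fun x => ∫ y, T y * fej N (x - y)) atTop (nhds L)) :
    (∃ B, ∀ y, |T y| ≤ B) ∧ Tendsto T atTop (nhds (L / ∫ y, fej 1 y)) := by
  obtain ⟨B, hB0, hB⟩ := taub_bounded T C hC hlow hslow hloc (hInt 1 one_pos) L (hlim 1 one_pos)
  refine ⟨⟨B, hB⟩, ?_⟩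
  set I0 := ∫ y, fej 1 y with hI0
  have hI0pos : 0 < I0 := fej_integral_pos
  set P := ∫ y : ℝ, 1 / (1 + y ^ 2) with hP
  have hP0 : 0 ≤ P := integral_nonneg fun y => by positivity
  rw [Metric.tendsto_atTop]
  intro e he
  set ε := min 1 (e / (2 * (2 / I0 + 2))) with hε
  have hε0 : 0 < ε := by
    rw [hε]; refine lt_min one_pos (by positivity)
  have hε1 : ε ≤ 1 := min_le_left _ _
  have hεe : ε * (2 / I0 + 2) < e := by
    have h1 : ε ≤ e / (2 * (2 / I0 + 2)) := min_le_right _ _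
    rw [le_div_iff₀ (by positivity)] at h1
    nlinarith
  obtain ⟨h0, hh0, x₀, hx₀, hs⟩ := hslow ε hε0
  set h := min h0 (ε / (B + 1)) with hh
  have hhpos : 0 < h := lt_min hh0 (by positivity)
  have hw : ∀ x y, x₀ ≤ x → x ≤ y → y ≤ x + h → T x - 2 * ε ≤ T y := by
    intro x y h1 h2 h3
    have a := hs x y h1 h2 (h3.trans (by linarith [min_le_left h0 (ε / (B + 1))]))
    have b : 1 - Real.exp (-(y - x)) ≤ h := by
      linarith [Real.add_one_le_exp (-(y - x))]
    have b0 : 0 ≤ 1 - Real.exp (-(y - x)) := by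
      rw [sub_nonneg, Real.exp_le_one_iff]; linarith
    have c1 : h * (B + 1) ≤ ε := by
      have := min_le_right h0 (ε / (B + 1))
      rw [← hh, le_div_iff₀ (by positivity)] at this
      exact this
    have d : (1 - Real.exp (-(y - x))) * (T x - ε) ≤ h * (B + 1) := by
      have d1 : T x - ε ≤ B + 1 := by linarith [(abs_le.1 (hB x)).2]
      calc _ ≤ (1 - Real.exp (-(y - x))) * (B + 1) := mul_le_mul_of_nonneg_left d1 b0
        _ ≤ _ := mul_le_mul_of_nonneg_right b (by linarith)
    nlinarith
  obtain ⟨N, hN, hNt⟩ : ∃ N, 0 < N ∧ (2 * B + 2) * (2 / N * (1 + 1 / (h / 2) ^ 2)) * P < ε := by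
    have : Tendsto (fun N : ℝ => (2 * B + 2) * (2 / N * (1 + 1 / (h / 2) ^ 2)) * P) atTop
        (nhds ((2 * B + 2) * (0 * (1 + 1 / (h / 2) ^ 2)) * P)) :=
      (((tendsto_const_nhds.div_atTop tendsto_id).mul_const _).const_mul _).mul_const _
    have h1 := (this.eventually_lt_const (u := ε) (by simpa using hε0)).and (eventually_gt_atTop 0)
    obtain ⟨N, hN⟩ := h1.exists
    exact ⟨N, hN.2, hN.1⟩
  obtain ⟨x₁, hx₁⟩ := (Metric.tendsto_atTop.1 (hlim N hN)) ε hε0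
  refine ⟨max (x₀ + h) (x₁ + h), fun x hx => ?_⟩
  have hxa : x₀ + h ≤ x := (le_max_left _ _).trans hx
  have hxb : x₁ + h ≤ x := (le_max_right _ _).trans hx
  have hTx := abs_le.1 (hB x)
  have up := window_ineq T B hB (T x - 2 * ε) (h / 2) N (x + h / 2) (by positivity) hN
    (by rw [abs_le]; constructor <;> linarith) hB0 (hInt N hN _) (by
      intro y hy
      rw [abs_le] at hy
      exact hw x y (by linarith) (by linarith) (by linarith))
  have dn := window_ineq (fun y => -T y) B (by simpa using hB) (-T x - 2 * ε) (h / 2) N (x - h / 2)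
    (by positivity) hN (by rw [abs_le]; constructor <;> linarith) hB0
    (by simpa using (hInt N hN (x - h / 2)).neg) (by
      intro y hy
      rw [abs_le] at hy
      have := hw y x (by linarith) (by linarith) (by linarith)
      linarith)
  have l1 := abs_lt.1 (hx₁ (x + h / 2) (by linarith))
  have l2 := abs_lt.1 (hx₁ (x - h / 2) (by linarith))
  simp only [neg_mul, integral_neg] at dn
  rw [← hI0, ← hP] at up dn
  have u1 : (T x - 2 * ε) * I0 < L + 2 * ε := by linarith [l1.2]
  have d1 : (-T x - 2 * ε) * I0 < -L + 2 * ε := by linarith [l2.1]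
  rw [Real.dist_eq, abs_lt]
  have e2 : ε * (2 / I0 + 2) = 2 * ε / I0 + 2 * ε := by ring
  rw [← lt_div_iff₀ hI0pos, add_div] at u1 d1
  rw [neg_div] at d1
  constructor <;> linarith


/-! ### Final assembly -/

lemma conv_int (S : ℝ → ℝ) (hSm : Measurable S)
    (hW : IntegrableOn (fun y => Real.exp (-y) * S y / (1 + y ^ 2)) (Ioi 0))
    (N : ℝ) (hN : 0 < N) (x : ℝ) :
    IntegrableOn (fun y => (Real.exp (-y) * S y) * fej N (x - y)) (Ioi 0) := by
  have fc := fej_cont N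
  have hTm : Measurable (fun y => Real.exp (-y) * S y) := by fun_prop
  refine Integrable.mono' (hW.norm.const_mul ((N / 2 + 2 / N) * (2 * (1 + x ^ 2))))
    (hTm.mul (by fun_prop : Continuous (fun y => fej N (x - y))).measurable).aestronglyMeasurable
    (Eventually.of_forall fun y => ?_)
  rw [norm_mul, norm_div, Real.norm_of_nonneg (by positivity : (0:ℝ) ≤ 1 + y ^ 2),
    Real.norm_of_nonneg (fej_nonneg hN _)]
  have a1 := fej_bound hN (x - y)
  rw [div_eq_mul_one_div] at a1
  have a2 := a1.trans (mul_le_mul_of_nonneg_left (shift_bound x y) (by positivity))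
  calc _ ≤ ‖Real.exp (-y) * S y‖ * ((N / 2 + 2 / N) * (2 * (1 + x ^ 2) / (1 + y ^ 2))) :=
        mul_le_mul_of_nonneg_left a2 (norm_nonneg _)
    _ = _ := by ring

lemma abelian (T : ℝ → ℝ) (hTm : Measurable T) (B : ℝ) (hB : ∀ y, |T y| ≤ B) (a : ℝ)
    (hT : Tendsto T atTop (nhds a)) :
    Tendsto (fun σ : ℝ => (σ - 1) * (σ * ∫ y in Ioi (0:ℝ), T y * Real.exp (-(σ - 1) * y)))
      (nhdsWithin 1 (Ioi 1)) (nhds a) := by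
  have hlim : Tendsto (fun σ : ℝ => ∫ v in Ioi (0:ℝ), T ((σ - 1)⁻¹ * v) * Real.exp (-v))
      (nhdsWithin 1 (Ioi 1)) (nhds (∫ v in Ioi (0:ℝ), a * Real.exp (-v))) := by
    refine tendsto_integral_filter_of_dominated_convergence (l := nhdsWithin (1:ℝ) (Ioi 1))
      (fun v => B * Real.exp (-v)) ?_ ?_ ?_ ?_
    · refine Eventually.of_forall fun σ => ?_
      exact ((hTm.comp (by fun_prop)).mul (by fun_prop)).aestronglyMeasurable
    · refine Eventually.of_forall fun σ => Eventually.of_forall fun v => ?_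
      rw [norm_mul, Real.norm_of_nonneg (Real.exp_pos _).le]
      exact mul_le_mul_of_nonneg_right (hB _) (Real.exp_pos _).le
    · exact (integrableOn_exp_neg_Ioi 0).const_mul B
    · rw [ae_restrict_iff' measurableSet_Ioi]
      refine Eventually.of_forall fun v (hv : 0 < v) => ?_
      refine Tendsto.mul_const _ (hT.comp ?_)
      refine Tendsto.atTop_mul_const hv ?_
      refine tendsto_inv_nhdsGT_zero.comp ?_
      refine tendsto_nhdsWithin_iff.2 ⟨?_, ?_⟩
      · have : Tendsto (fun σ : ℝ => σ - 1) (nhds 1) (nhds (1 - 1)) :=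
          (continuous_id.sub continuous_const).tendsto _
        rw [sub_self] at this
        exact this.mono_left nhdsWithin_le_nhds
      · filter_upwards [self_mem_nhdsWithin] with σ (hσ : 1 < σ)
        exact sub_pos.2 hσ
  have hval : ∫ v in Ioi (0:ℝ), a * Real.exp (-v) = a := by
    rw [integral_const_mul, integral_exp_neg_Ioi_zero, mul_one]
  rw [hval] at hlim
  have hid : Tendsto (fun σ : ℝ => σ) (nhdsWithin 1 (Ioi 1)) (nhds 1) :=
    tendsto_id.mono_left nhdsWithin_le_nhds
  have h2 := hid.mul hlim
  rw [one_mul] at h2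
  refine h2.congr' ?_
  filter_upwards [self_mem_nhdsWithin] with σ (hσ : 1 < σ)
  have hpos : 0 < σ - 1 := sub_pos.2 hσ
  have := integral_comp_mul_left_Ioi (fun v => T ((σ - 1)⁻¹ * v) * Real.exp (-v)) 0 hpos
  rw [mul_zero, smul_eq_mul] at this
  have e : ∀ y, T ((σ - 1)⁻¹ * ((σ - 1) * y)) * Real.exp (-((σ - 1) * y))
      = T y * Real.exp (-(σ - 1) * y) := by
    intro y
    rw [inv_mul_cancel_left₀ hpos.ne', neg_mul]
  simp_rw [e] at this
  rw [this]
  field_simp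

/-- Theorem 1.3 for the Laplace–Stieltjes transform.
Here the locally finite signed Borel measure `μ` on `[0,∞)` is represented by the
Jordan-type decomposition `μ = μp - μm` into locally finite nonnegative measures,
and `S x = μ([0,x])`. -/
theorem wiener_ikehara_stieltjes_B1 (μp μm : Measure ℝ)
    [IsLocallyFiniteMeasure μp] [IsLocallyFiniteMeasure μm]
    (hμp : μp (Iio 0) = 0) (hμm : μm (Iio 0) = 0)
    (hconv : ∀ s : ℂ, 1 < s.re →
      Integrable (fun x : ℝ => Complex.exp (-s * x)) μp ∧
      Integrable (fun x : ℝ => Complex.exp (-s * x)) μm)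
    (S : ℝ → ℝ) (hSdef : ∀ x : ℝ, S x = (μp (Icc 0 x)).toReal - (μm (Icc 0 x)).toReal)
    (hslow : LogLinSlowlyDecreasing S)
    (U : ℂ → ℝ) (hU : ∀ s : ℂ, U s = (laplaceStieltjes μp μm s).re)
    (hbd : L1locBoundaryBehavior U)
    (lam : ℝ) (hlam : 0 < lam)
    (c : ℝ) (hc : 0 ≤ c)
    (hlow : ∀ t ∈ Ioo (-lam) lam, ∀ σ ∈ Ioc (1 : ℝ) 2,
      -c ≤ U (σ + t * Complex.I)) :
    ∃ a : ℝ,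
      Tendsto (fun σ : ℝ => (σ - 1) * U σ) (nhdsWithin 1 (Ioi 1)) (nhds a) ∧
      Tendsto (fun x : ℝ => Real.exp (-x) * S x) atTop (nhds a) := by
  have hcp := fun s hs => (hconv s hs).1
  have hcm := fun s hs => (hconv s hs).2
  have hSeq : S = fun x => (μp (Icc 0 x)).toReal - (μm (Icc 0 x)).toReal := funext hSdef
  have hSm : Measurable S := by
    rw [hSeq]; exact (meas_mono μp).measurable.sub (meas_mono μm).measurable
  have hInt : ∀ σ, 1 < σ → IntegrableOn (fun y => Real.exp (-σ * y) * S y) (Ioi 0) := by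
    intro σ hσ
    refine ((meas_exp_integrable μp hcp σ hσ).sub (meas_exp_integrable μm hcm σ hσ)).congr
      (Eventually.of_forall fun y => ?_)
    simp only [hSdef, Pi.sub_apply]
    ring
  have hloc : ∀ X, ∃ B, ∀ y, 0 ≤ y → y ≤ X → |Real.exp (-y) * S y| ≤ B := by
    intro X
    refine ⟨(μp (Icc 0 X)).toReal + (μm (Icc 0 X)).toReal, fun y h0 h1 => ?_⟩
    have a1 := meas_mono μp h1
    have a2 := meas_mono μm h1
    simp only at a1 a2
    have b1 : 0 ≤ (μp (Icc 0 y)).toReal := ENNReal.toReal_nonneg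
    have b2 : 0 ≤ (μm (Icc 0 y)).toReal := ENNReal.toReal_nonneg
    have c1 : |S y| ≤ (μp (Icc 0 X)).toReal + (μm (Icc 0 X)).toReal := by
      rw [hSdef, abs_le]; constructor <;> linarith
    rw [abs_mul, abs_of_pos (Real.exp_pos _)]
    refine (mul_le_of_le_one_left (abs_nonneg _) ?_).trans c1
    rw [Real.exp_le_one_iff]; linarith
  obtain ⟨C, hC, hTlow⟩ := T_lower S hslow hloc
  -- the boundary data
  have hdiff : DifferentiableOn ℂ (laplaceStieltjes μp μm) {s | 1 < s.re} :=
    (lap_diff μp hcp).sub (lap_diff μm hcm)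
  obtain ⟨δ, M, hδ, hM⟩ := rect_bound (laplaceStieltjes μp μm) hdiff lam hlam c hc
    (fun t ht σ hσ => by rw [← hU]; exact hlow t ht σ hσ)
  obtain ⟨f, hf⟩ := hbd
  set u : ℝ → ℝ → ℝ := fun σ t => U (σ + t * Complex.I) with hu_def
  have hu : ∀ σ, 1 < σ → Continuous (u σ) := by
    intro σ hσ
    have h1 : Continuous (fun t : ℝ => laplaceStieltjes μp μm (σ + t * Complex.I)) := by
      refine hdiff.continuousOn.comp_continuous (by fun_prop) fun t => ?_
      simpa using hσ
    simp only [hu_def, hU]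
    exact Complex.continuous_re.comp h1
  have hM' : ∀ σ, 1 < σ → σ < 2 → ∫ t in (0:ℝ)..δ, |u σ t| ≤ M := by
    intro σ h1 h2
    simp only [hu_def, hU]
    exact hM σ h1 h2
  have hf' : ∀ a b, 0 < a → a ≤ b → IntegrableOn f (Icc a b) ∧
      Tendsto (fun σ => ∫ t in a..b, |u σ t - f t|) (nhdsWithin 1 (Ioi 1)) (nhds 0) := by
    intro a b ha hab
    exact hf a b hab (fun h => absurd h.1 (not_le.2 ha))
  have hfI := f_integrable u f hu δ M hδ hM' hf'
  obtain ⟨s, A, hs1, hs2, hs, hweak⟩ := weak_seq u f hu δ M hδ hM' hf'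
  have hform : ∀ σ t, 1 < σ → u σ t = ∫ y in Ioi (0:ℝ), (Real.exp (-σ * y) * S y) *
      (σ * Real.cos (t * y) + t * Real.sin (t * y)) := by
    intro σ t hσ
    simp only [hu_def, hU]
    exact U_formula μp μm hμp hμm hconv S hSdef σ t hσ
  have hqc : ∀ σ N x : ℝ, 0 < σ → Continuous (fun t => (1 - t / N) * symP σ t x) := by
    intro σ N x hσ
    refine Continuous.mul (by fun_prop) ?_
    unfold symP
    apply Continuous.div (by fun_prop) (by fun_prop)
    intro t; positivity
  have hlimC : ∀ N x, 0 < N → Tendsto (fun n => ∫ y in Ioi (0:ℝ),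
      (Real.exp (-(s n) * y) * S y) * kerC (s n) N x y) atTop
      (nhds ((∫ t in (0:ℝ)..N, f t * ((1 - t / N) * symP 1 t x)) + A)) := by
    intro N x hN
    have h := hweak N hN (fun t => (1 - t / N) * symP 1 t x)
      (fun n t => (1 - t / N) * symP (s n) t x) (fun n => 7 * (s n - 1)) (hqc 1 N x one_pos)
      (fun n => hqc (s n) N x (by linarith [hs1 n]))
      (by
        have : Tendsto (fun n => 7 * (s n - 1)) atTop (nhds (7 * (1 - 1))) :=
          (hs.sub_const 1).const_mul 7
        simpa using this)
      (by
        intro n t ht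
        rw [← mul_sub, abs_mul]
        have h0 : 0 ≤ 1 - t / N := by rw [sub_nonneg, div_le_one hN]; exact ht.2
        have h1 : 1 - t / N ≤ 1 := by linarith [div_nonneg ht.1 hN.le]
        rw [abs_of_nonneg h0]
        exact (mul_le_of_le_one_left (abs_nonneg _) h1).trans
          (symP_diff (hs1 n).le (hs2 n).le t x))
    have q0 : (1 - (0:ℝ) / N) * symP 1 0 x = 1 := by simp [symP]
    simp only [q0, mul_one] at h
    refine h.congr fun n => ?_
    rw [← fubini_id S (s n) N x (hs1 n) hN (hInt _ (hs1 n))]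
    refine intervalIntegral.integral_congr fun t _ => ?_
    rw [hform (s n) t (hs1 n)]
  -- weighted integrability
  have hW : IntegrableOn (fun y => Real.exp (-y) * S y / (1 + y ^ 2)) (Ioi 0) := by
    obtain ⟨B, hB⟩ := (hlimC 1 0 one_pos).bddAbove_range
    exact T_weighted S hSm hloc C hC hTlow s hs1 hs2 hs hInt B
      (fun n => hB (mem_range_self n))
  have hconvlim : ∀ N, 0 < N → Tendsto (fun x => ∫ y in Ioi (0:ℝ),
      (Real.exp (-y) * S y) * fej N (x - y)) atTop (nhds (2 * A)) := by
    intro N hN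
    exact conv_limit S hSm hW N hN A _ (rl_term f N hN (hfI N))
      (fun x => core_identity S hSm hW s hs1 hs2 hs N x hN _ (hlimC N x hN))
  -- Tauberian part
  set T : ℝ → ℝ := (Ioi (0:ℝ)).indicator (fun y => Real.exp (-y) * S y) with hT
  have hTpos : ∀ y, 0 < y → T y = Real.exp (-y) * S y := fun y hy => by
    rw [hT, indicator_of_mem (mem_Ioi.2 hy)]
  have hTneg : ∀ y, y ≤ 0 → T y = 0 := fun y hy => by
    rw [hT, indicator_of_notMem (by simpa using hy)]
  have hTm : Measurable T := Measurable.indicator (by fun_prop) measurableSet_Ioi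
  have hTmul : ∀ N x, (fun y => T y * fej N (x - y)) = (Ioi (0:ℝ)).indicator
      (fun y => (Real.exp (-y) * S y) * fej N (x - y)) := by
    intro N x
    ext y
    by_cases hy : y ∈ Ioi (0:ℝ) <;> simp [hT, hy]
  obtain ⟨⟨B, hB⟩, hlimT⟩ := taub_main T C hC
    (by
      intro y
      rcases lt_or_ge 0 y with hy | hy
      · rw [hTpos y hy]; exact hTlow y hy.le
      · rw [hTneg y hy]; linarith)
    (by
      intro ε hε
      obtain ⟨h, hh, x₀, hx₀, hs⟩ := hslow ε hε
      refine ⟨h, hh, x₀, hx₀, fun x y h1 h2 h3 => ?_⟩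
      have h4 := hs x y h1 h2 h3
      rw [hTpos x (by linarith), hTpos y (by linarith)]
      have h5 := (le_div_iff₀ (Real.exp_pos x)).1 h4
      have e1 : Real.exp (-(y - x)) = Real.exp (-y) * Real.exp x := by
        rw [← Real.exp_add]; congr 1; ring
      have e2 : Real.exp x * Real.exp (-x) = 1 := by
        rw [← Real.exp_add]; simp
      calc Real.exp (-(y - x)) * (Real.exp (-x) * S x - ε)
          = Real.exp (-y) * ((Real.exp x * Real.exp (-x)) * S x - ε * Real.exp x) := by
            rw [e1]; ring
        _ ≤ Real.exp (-y) * S y := by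
            rw [e2]
            exact mul_le_mul_of_nonneg_left (by linarith) (Real.exp_pos _).le)
    (by
      intro X
      obtain ⟨B, hB⟩ := hloc (max X 0)
      have hB0 : 0 ≤ B := (abs_nonneg _).trans (hB 0 le_rfl (le_max_right _ _))
      refine ⟨B, fun y hy => ?_⟩
      rcases lt_or_ge 0 y with h | h
      · rw [hTpos y h]; exact hB y h.le (hy.trans (le_max_left _ _))
      · rw [hTneg y h]; simpa using hB0)
    (by
      intro N hN x
      rw [hTmul]
      exact (conv_int S hSm hW N hN x).integrable_indicator measurableSet_Ioi)
    (2 * A)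
    (by
      intro N hN
      refine (hconvlim N hN).congr fun x => ?_
      rw [hTmul, integral_indicator measurableSet_Ioi])
  refine ⟨2 * A / ∫ y, fej 1 y, ?_, ?_⟩
  rotate_left
  · refine hlimT.congr' ?_
    filter_upwards [eventually_gt_atTop 0] with x hx
    exact hTpos x hx
  · refine (abelian T hTm B hB _ hlimT).congr' ?_
    filter_upwards [self_mem_nhdsWithin] with σ (hσ : 1 < σ)
    congr 1
    have h1 : U σ = u σ 0 := by simp [hu_def]
    rw [h1, hform σ 0 hσ, ← integral_const_mul]
    refine setIntegral_congr_fun measurableSet_Ioi fun y (hy : 0 < y) => ?_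
    simp only [zero_mul, Real.cos_zero, mul_one, add_zero]
    rw [hTpos y hy]
    have : Real.exp (-σ * y) = Real.exp (-y) * Real.exp (-(σ - 1) * y) := by
      rw [← Real.exp_add]; congr 1; ring
    rw [this]; ring
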